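/- arXiv:math/0201001 — 2 statements merged into one kernel-verified Lean document; each statement's English description precedes it below -/
import Mathlib

section
/- Let (M, τ) be a tracial W*-probability space and A, B ⊂ M unital *-subalgebras which are algebraically free. Let D ⊂ B be a finite-dimensional unital *-subalgebra of B with a conditional expectation E: M → D such that τ∘E = τ. If the scalar-valued liberation gradient j_ℂ(A:B) exists, then the following are equivalent: (i) j_ℂ(A:D) = j_ℂ(A:B); (ii) A is free from B with amalgamation over D. -/
/-!  Statement 16 (Theorem 6.1):  for algebraically free `A, B` and finite-dimensional `D ⊆ B`, if `j_ℂ(A:B)` exists then `j_ℂ(A:D) = j_ℂ(A:B)` iff `A` is free from `B` with amalgamation over `D`.  (The equality of the two liberation gradients is expressed by saying that `j_ℂ(A:B)` also satisfies the defining property of `j_ℂ(A:D)`.) -/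

open scoped Classical ENNReal

noncomputable section

namespace OVD

variable {M : Type*} [Ring M] [Algebra ℂ M] [StarRing M] [StarModule ℂ M]

/-- `τ` is a faithful tracial state on the complex `*`-algebra `M`
(the normality and von Neumann algebra structure of a tracial
`W*`-probability space are not used in the algebraic statement). -/
structure IsFaithfulTracialState [StarRing M] (τ : M →ₗ[ℂ] ℂ) : Prop where
  unital : τ 1 = 1
  tracial : ∀ x y, τ (x * y) = τ (y * x)
  pos : ∀ x, 0 ≤ (τ (star x * x)).re ∧ (τ (star x * x)).im = 0
  faithful : ∀ x, τ (star x * x) = 0 → x = 0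

/-- `E : M → M` is a conditional expectation onto the unital subalgebra `B`. -/
def IsCondExp (B : Subalgebra ℂ M) (E : M →ₗ[ℂ] M) : Prop :=
  E 1 = 1 ∧ (∀ x, E x ∈ B) ∧ ∀ b ∈ B, ∀ b' ∈ B, ∀ x, E (b * x * b') = b * E x * b'

/-- Two subsets `S₁, S₂` of `A` (each thought of as a subalgebra containing the
base algebra) are free with amalgamation with respect to the conditional
expectation `E` (valued in the module `W`):  every alternating product of
`E`-centered elements is `E`-centered. -/
def IsFreeWithAmalgamation {A W : Type*} [Ring A] [Algebra ℂ A]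
    [AddCommGroup W] [Module ℂ W] (E : A →ₗ[ℂ] W) (S₁ S₂ : Set A) : Prop :=
  ∀ (k : ℕ), 0 < k → ∀ (a : Fin k → A) (f : Fin k → Bool),
    (∀ j, a j ∈ (if f j then S₁ else S₂)) →
    (∀ j, E (a j) = 0) →
    (∀ (j : ℕ) (h : j + 1 < k), f ⟨j, Nat.lt_of_succ_lt h⟩ ≠ f ⟨j + 1, h⟩) →
    E ((List.ofFn a).prod) = 0

/-- the `L²`-distance with respect to the trace `τ`: `‖x − y‖₂`. -/
def l2Dist [StarRing M] (τ : M →ₗ[ℂ] ℂ) (x y : M) : ℝ :=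
  Real.sqrt ((τ ((x - y) * star (x - y))).re)

/-- `x` belongs to `L²(S)`, the `‖·‖₂`-closure of the (star-)algebra
generated by `S`, (intersected with `M`; conjugate variables and liberation
gradients are modelled as elements of `M` here). -/
def MemL2Closure [StarRing M] (τ : M →ₗ[ℂ] ℂ) (S : Set M) (x : M) : Prop :=
  ∀ ε : ℝ, 0 < ε → ∃ a ∈ Algebra.adjoin ℂ (S ∪ star '' S), l2Dist τ x a < ε

/-- the alternating word `c₁c̃₁ c₂c̃₂ ⋯ c_m c̃_m`. -/
def pairWord {m : ℕ} (c c' : Fin m → M) : M :=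
  (List.ofFn fun r : Fin m => c r * c' r).prod

/-- the part `c₁c̃₁ ⋯ c_{r-1}c̃_{r-1}` of an alternating word before the
(`0`-indexed) position `r`. -/
def pairWordBefore {m : ℕ} (c c' : Fin m → M) (r : Fin m) : M :=
  (((List.finRange m).filter fun s : Fin m => decide ((s : ℕ) < (r : ℕ))).map
      fun s => c s * c' s).prod

/-- the part `c_{r+1}c̃_{r+1} ⋯ c_m c̃_m` of an alternating word after the
(`0`-indexed) position `r`. -/
def pairWordAfter {m : ℕ} (c c' : Fin m → M) (r : Fin m) : M :=
  (((List.finRange m).filter fun s : Fin m => decide ((r : ℕ) < (s : ℕ))).map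
      fun s => c s * c' s).prod

/-- the defining equations of the liberation gradient `j = j(A₁ : A₂)` with
respect to the conditional expectation `E`, in their explicit form
`E(j c₁c̃₁ ⋯ c_mc̃_m) = ∑_r ( E(c₁c̃₁⋯c̃_{r-1}c_r) E(c̃_r c_{r+1}⋯c_mc̃_m)
− E(c₁c̃₁⋯c_{r-1}c̃_{r-1}) E(c_rc̃_r⋯c_mc̃_m) )`
(equivalent to `E(ja) = (E ⊗ E)(δ_{A₁:A₂} a)` for all `a ∈ A₁ ∨ A₂`). -/
def LiberationEquations {W : Type*} [Ring W] [Algebra ℂ W] (E : M →ₗ[ℂ] W)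
    (S₁ S₂ : Set M) (j : M) : Prop :=
  ∀ (m : ℕ) (c c' : Fin m → M), (∀ r, c r ∈ S₁) → (∀ r, c' r ∈ S₂) →
    E (j * pairWord c c') =
      ∑ r : Fin m,
        (E (pairWordBefore c c' r * c r) * E (c' r * pairWordAfter c c' r) -
          E (pairWordBefore c c' r) * E (c r * c' r * pairWordAfter c c' r))

/-- `j` is the liberation gradient `j_B(A₁ : A₂)` (for `E : M → B ⊆ M`), resp.
`j_ℂ(A₁ : A₂)` (for `E = τ : M → ℂ`):  it lies in `L²(A₁, A₂)` and satisfies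
the defining equations `E(ja) = (E ⊗ E)(δ_{A₁:A₂} a)`. -/
def IsLiberationGradient [StarRing M] (τ : M →ₗ[ℂ] ℂ) {W : Type*} [Ring W]
    [Algebra ℂ W] (E : M →ₗ[ℂ] W) (S₁ S₂ : Set M) (j : M) : Prop :=
  MemL2Closure τ (S₁ ∪ S₂) j ∧ LiberationEquations E S₁ S₂ j

/-- the relative commutant `B′ ∩ M`. -/
def relativeCommutant (B : Subalgebra ℂ M) : Set M :=
  {x : M | ∀ b ∈ B, b * x = x * b}

/-- the canonical evaluation map from the free algebra on (the disjoint union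
of) `A₁` and `A₂` to `M`. -/
def freeWordMap (A₁ A₂ : Subalgebra ℂ M) : FreeAlgebra ℂ (↥A₁ ⊕ ↥A₂) →ₐ[ℂ] M :=
  FreeAlgebra.lift ℂ (Sum.elim (fun a : ↥A₁ => (a : M)) (fun a : ↥A₂ => (a : M)))

/-- the defining relations of the amalgamated free product `A₁ *_B A₂`
inside the free algebra on `A₁ ⊕ A₂`. -/
def freeProductRelations (B A₁ A₂ : Subalgebra ℂ M) (h₁ : B ≤ A₁) (h₂ : B ≤ A₂) :
    Set (FreeAlgebra ℂ (↥A₁ ⊕ ↥A₂)) :=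
  {x | (∃ a a' : ↥A₁, x = FreeAlgebra.ι ℂ (Sum.inl (a * a')) -
          FreeAlgebra.ι ℂ (Sum.inl a) * FreeAlgebra.ι ℂ (Sum.inl a')) ∨
       (∃ a a' : ↥A₁, x = FreeAlgebra.ι ℂ (Sum.inl (a + a')) -
          FreeAlgebra.ι ℂ (Sum.inl a) - FreeAlgebra.ι ℂ (Sum.inl a')) ∨
       (∃ (z : ℂ) (a : ↥A₁), x = FreeAlgebra.ι ℂ (Sum.inl (z • a)) -
          z • FreeAlgebra.ι ℂ (Sum.inl a)) ∨
       (∃ a a' : ↥A₂, x = FreeAlgebra.ι ℂ (Sum.inr (a * a')) -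
          FreeAlgebra.ι ℂ (Sum.inr a) * FreeAlgebra.ι ℂ (Sum.inr a')) ∨
       (∃ a a' : ↥A₂, x = FreeAlgebra.ι ℂ (Sum.inr (a + a')) -
          FreeAlgebra.ι ℂ (Sum.inr a) - FreeAlgebra.ι ℂ (Sum.inr a')) ∨
       (∃ (z : ℂ) (a : ↥A₂), x = FreeAlgebra.ι ℂ (Sum.inr (z • a)) -
          z • FreeAlgebra.ι ℂ (Sum.inr a)) ∨
       (x = FreeAlgebra.ι ℂ (Sum.inl (1 : ↥A₁)) - 1) ∨
       (x = FreeAlgebra.ι ℂ (Sum.inr (1 : ↥A₂)) - 1) ∨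
       (∃ b : ↥B, x = FreeAlgebra.ι ℂ (Sum.inl (⟨(b : M), h₁ b.2⟩ : ↥A₁)) -
          FreeAlgebra.ι ℂ (Sum.inr (⟨(b : M), h₂ b.2⟩ : ↥A₂)))}

/-- `A₁` and `A₂` are algebraically free modulo `B`:  the canonical
homomorphism `A₁ *_B A₂ → A₁ ∨ A₂ ⊆ M` has trivial kernel, i.e. every element
of the free algebra on `A₁ ⊕ A₂` which maps to `0` in `M` already lies in the
two-sided ideal of defining relations of `A₁ *_B A₂`. -/
def AlgebraicallyFreeModulo (B A₁ A₂ : Subalgebra ℂ M) (h₁ : B ≤ A₁)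
    (h₂ : B ≤ A₂) : Prop :=
  ∀ x : FreeAlgebra ℂ (↥A₁ ⊕ ↥A₂), freeWordMap A₁ A₂ x = 0 →
    x ∈ TwoSidedIdeal.span (freeProductRelations B A₁ A₂ h₁ h₂)

section Words

variable {R : Type*} [Ring R]

/-- The product `c₁d₁ c₂d₂ ⋯` of a list of pairs `(cᵢ, dᵢ)`. -/
def pairProd (w : List (R × R)) : R :=
  (w.map fun x => x.1 * x.2).prod

@[simp]
theorem pairProd_nil : pairProd ([] : List (R × R)) = 1 := by
  simp [pairProd]

@[simp]
theorem pairProd_cons (x : R × R) (w : List (R × R)) :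
    pairProd (x :: w) = x.1 * x.2 * pairProd w := by
  simp [pairProd]

@[simp]
theorem pairProd_append (v w : List (R × R)) :
    pairProd (v ++ w) = pairProd v * pairProd w := by
  simp [pairProd]

theorem pairWord_get (w : List (R × R)) :
    pairWord (fun i => (w.get i).1) (fun i => (w.get i).2) = pairProd w := by
  unfold pairWord pairProd
  rw [← List.ofFn_get w, List.map_ofFn]
  simp [Function.comp_def]

/-- The product of the letters of a word whose letters are tagged by a Boolean. -/
def wordProd (w : List (Bool × R)) : R :=
  (w.map Prod.snd).prod

@[simp]
theorem wordProd_nil : wordProd ([] : List (Bool × R)) = 1 := by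
  simp [wordProd]

@[simp]
theorem wordProd_cons (x : Bool × R) (w : List (Bool × R)) :
    wordProd (x :: w) = x.2 * wordProd w := by
  simp [wordProd]

@[simp]
theorem wordProd_append (v w : List (Bool × R)) :
    wordProd (v ++ w) = wordProd v * wordProd w := by
  simp [wordProd]

end Words

section PartialGradient

variable {R : Type*} [Ring R] [Algebra ℂ R]

/-- The value of `φ` on `p ⊗ 1` times the free difference quotient of the word `pairProd w`, where
the derivation sends first components `c` to `c ⊗ 1 - 1 ⊗ c` and second components to `0`. -/
def freeDifference (φ : R →ₗ[ℂ] R →ₗ[ℂ] ℂ) : R → List (R × R) → ℂ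
  | _, [] => 0
  | p, x :: w =>
    φ (p * x.1) (x.2 * pairProd w) - φ p (x.1 * x.2 * pairProd w) +
      freeDifference φ (p * (x.1 * x.2)) w

theorem freeDifference_add (φ : R →ₗ[ℂ] R →ₗ[ℂ] ℂ) (w : List (R × R)) :
    ∀ p q : R, freeDifference φ (p + q) w = freeDifference φ p w + freeDifference φ q w := by
  induction w with
  | nil => simp [freeDifference]
  | cons x w ih =>
    intro p q
    simp only [freeDifference, add_mul, map_add, LinearMap.add_apply, ih]
    ring

/-- The sum in the liberation equations, written recursively. -/
theorem sum_pairWord_eq_freeDifference (φ : R →ₗ[ℂ] R →ₗ[ℂ] ℂ) :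
    ∀ (m : ℕ) (c c' : Fin m → R) (p : R),
      ∑ r : Fin m, (φ (p * pairWordBefore c c' r * c r) (c' r * pairWordAfter c c' r) -
        φ (p * pairWordBefore c c' r) (c r * c' r * pairWordAfter c c' r)) =
      freeDifference φ p (List.ofFn fun r => (c r, c' r)) := by
  intro m
  induction m with
  | zero => simp [freeDifference]
  | succ m ih =>
    intro c c' p
    have hb0 : pairWordBefore c c' 0 = 1 := by simp [pairWordBefore]
    have ha0 : pairWordAfter c c' 0 = pairProd (List.ofFn fun r : Fin m =>
        (c r.succ, c' r.succ)) := by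
      simp [pairWordAfter, pairProd, List.finRange_succ, List.filter_map, Function.comp_def,
        List.ofFn_eq_map]
    have hb (r : Fin m) : pairWordBefore c c' r.succ =
        c 0 * c' 0 * pairWordBefore (fun i => c i.succ) (fun i => c' i.succ) r := by
      simp [pairWordBefore, List.finRange_succ, List.filter_map, Function.comp_def]
    have ha (r : Fin m) : pairWordAfter c c' r.succ =
        pairWordAfter (fun i => c i.succ) (fun i => c' i.succ) r := by
      simp [pairWordAfter, List.finRange_succ, List.filter_map, Function.comp_def]
    rw [Fin.sum_univ_succ, List.ofFn_succ, freeDifference, ← ih]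
    simp only [hb0, ha0, hb, ha, mul_one, mul_assoc]

/-- `s` is the functional `r ↦ φ (δ(p) (1 ⊗ r))`, where `δ` is the derivation for which `j`
represents `φ ∘ δ` on the algebra generated by `A` and `B`. -/
def IsPartialGradient (τ : R →ₗ[ℂ] ℂ) (φ : R →ₗ[ℂ] R →ₗ[ℂ] ℂ) (A B : Subalgebra ℂ R) (j p : R)
    (s : R →ₗ[ℂ] ℂ) : Prop :=
  ∀ w : List (R × R), (∀ x ∈ w, x.1 ∈ A ∧ x.2 ∈ B) →
    τ (j * p * pairProd w) = s (pairProd w) + freeDifference φ p w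

/-- The bilinear form `(u, v) ↦ τ(u) τ(v)`. -/
def tensorTrace (τ : R →ₗ[ℂ] ℂ) : R →ₗ[ℂ] R →ₗ[ℂ] ℂ :=
  (LinearMap.mul ℂ ℂ).compl₁₂ τ τ

@[simp]
theorem tensorTrace_apply (τ : R →ₗ[ℂ] ℂ) (u v : R) : tensorTrace τ u v = τ u * τ v := rfl

theorem LiberationEquations.isPartialGradient {τ : R →ₗ[ℂ] ℂ} {A B : Subalgebra ℂ R} {j : R}
    (h : LiberationEquations τ (A : Set R) (B : Set R) j) :
    IsPartialGradient τ (tensorTrace τ) A B j 1 0 := by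
  intro w hw
  have key := h w.length (fun i => (w.get i).1) (fun i => (w.get i).2)
    (fun i => (hw _ (List.get_mem w i)).1) (fun i => (hw _ (List.get_mem w i)).2)
  have hs := sum_pairWord_eq_freeDifference (tensorTrace τ) w.length
    (fun i => (w.get i).1) (fun i => (w.get i).2) 1
  simp only [tensorTrace_apply, one_mul] at hs
  rw [pairWord_get, hs] at key
  rw [mul_one, key, LinearMap.zero_apply, zero_add]
  congr 1
  exact List.ofFn_get w

namespace IsPartialGradient

variable {τ : R →ₗ[ℂ] ℂ} {φ : R →ₗ[ℂ] R →ₗ[ℂ] ℂ} {A B : Subalgebra ℂ R} {j p q : R}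
  {s t : R →ₗ[ℂ] ℂ}

theorem apply_one (h : IsPartialGradient τ φ A B j p s) : τ (j * p) = s 1 := by
  simpa [freeDifference] using h [] (by simp)

theorem add (hp : IsPartialGradient τ φ A B j p s) (hq : IsPartialGradient τ φ A B j q t) :
    IsPartialGradient τ φ A B j (p + q) (s + t) := by
  intro w hw
  rw [freeDifference_add, mul_add, add_mul, map_add, hp w hw, hq w hw, LinearMap.add_apply]
  ring

theorem mul_left_mem (h : IsPartialGradient τ φ A B j p s) {a : R} (ha : a ∈ A) :
    IsPartialGradient τ φ A B j (p * a)
      (s ∘ₗ LinearMap.mulLeft ℂ a + φ (p * a) - φ p ∘ₗ LinearMap.mulLeft ℂ a) := by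
  intro w hw
  have := h ((a, 1) :: w) (by
    rintro x (_ | ⟨_, hx⟩)
    exacts [⟨ha, one_mem _⟩, hw x hx])
  simp only [pairProd_cons, mul_one, freeDifference, one_mul] at this
  simp only [LinearMap.sub_apply, LinearMap.add_apply, LinearMap.comp_apply,
    LinearMap.mulLeft_apply]
  rw [← mul_assoc j, mul_assoc _ a, this]
  ring

theorem mul_right_mem (h : IsPartialGradient τ φ A B j p s) {b : R} (hb : b ∈ B) :
    IsPartialGradient τ φ A B j (p * b) (s ∘ₗ LinearMap.mulLeft ℂ b) := by
  intro w hw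
  have := h ((1, b) :: w) (by
    rintro x (_ | ⟨_, hx⟩)
    exacts [⟨one_mem _, hb⟩, hw x hx])
  simp only [pairProd_cons, mul_one, freeDifference, one_mul] at this
  simp only [LinearMap.comp_apply, LinearMap.mulLeft_apply]
  rw [← mul_assoc j, mul_assoc _ b, this]
  ring

/-- If `φ` is balanced over `D ≤ B`, then `δ(n) = n ⊗ 1 - 1 ⊗ n` under `φ` for all `n ∈ A ∨ D`. -/
theorem mul_sup_mem {D : Subalgebra ℂ R} (hDB : D ≤ B)
    (hφ : ∀ d ∈ D, ∀ u v, φ (u * d) v = φ u (d * v)) {n : R} (hn : n ∈ A ⊔ D) :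
    ∀ {p : R} {s : R →ₗ[ℂ] ℂ}, IsPartialGradient τ φ A B j p s →
      IsPartialGradient τ φ A B j (p * n)
        (s ∘ₗ LinearMap.mulLeft ℂ n + φ (p * n) - φ p ∘ₗ LinearMap.mulLeft ℂ n) := by
  have hD : ∀ d ∈ D, ∀ {p : R} {s : R →ₗ[ℂ] ℂ}, IsPartialGradient τ φ A B j p s →
      IsPartialGradient τ φ A B j (p * d)
        (s ∘ₗ LinearMap.mulLeft ℂ d + φ (p * d) - φ p ∘ₗ LinearMap.mulLeft ℂ d) := by
    intro d hd p s h
    convert h.mul_right_mem (hDB hd) using 1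
    ext r
    simp [hφ d hd]
  rw [Algebra.sup_def] at hn
  induction hn using Algebra.adjoin_induction with
  | mem x hx =>
    intro p s h
    rcases hx with hx | hx
    exacts [h.mul_left_mem hx, hD x hx h]
  | algebraMap z => exact hD _ (D.algebraMap_mem z)
  | add x y _ _ hx hy =>
    intro p s h
    convert (hx h).add (hy h) using 1
    · rw [mul_add]
    · ext r
      simp only [LinearMap.sub_apply, LinearMap.add_apply, LinearMap.comp_apply,
        LinearMap.mulLeft_apply, mul_add, add_mul, map_add]
      ring
  | mul x y _ _ hx hy =>
    intro p s h
    convert hy (hx h) using 1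
    · rw [mul_assoc]
    · ext r
      simp only [LinearMap.sub_apply, LinearMap.add_apply, LinearMap.comp_apply,
        LinearMap.mulLeft_apply, mul_assoc]
      ring

/-- For `n ∈ A ∨ D` the derivation of `n` does not contribute as soon as
`p` or `r` is orthogonal to `A ∨ D`. -/
theorem exists_mul_sup_mem {D : Subalgebra ℂ R} (hDB : D ≤ B) {n : R} (hn : n ∈ A ⊔ D) :
    ∀ {p : R} {s : R →ₗ[ℂ] ℂ}, IsPartialGradient τ (tensorTrace τ) A B j p s →
      ∃ s', IsPartialGradient τ (tensorTrace τ) A B j (p * n) s' ∧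
        ∀ r, ((∀ m ∈ A ⊔ D, τ (p * m) = 0) ∨ ∀ m ∈ A ⊔ D, τ (m * r) = 0) →
          s' r = s (n * r) := by
  have hD : ∀ d ∈ D, ∀ {p : R} {s : R →ₗ[ℂ] ℂ}, IsPartialGradient τ (tensorTrace τ) A B j p s →
      ∃ s', IsPartialGradient τ (tensorTrace τ) A B j (p * d) s' ∧
        ∀ r, ((∀ m ∈ A ⊔ D, τ (p * m) = 0) ∨ ∀ m ∈ A ⊔ D, τ (m * r) = 0) →
          s' r = s (d * r) := fun d hd p s h =>
    ⟨_, h.mul_right_mem (hDB hd), fun r _ => rfl⟩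
  have hn' := hn
  rw [Algebra.sup_def] at hn'
  induction hn' using Algebra.adjoin_induction with
  | mem x hx =>
    intro p s h
    rcases hx with hx | hx
    · refine ⟨_, h.mul_left_mem hx, fun r hr => ?_⟩
      simp only [LinearMap.sub_apply, LinearMap.add_apply, LinearMap.comp_apply,
        LinearMap.mulLeft_apply, tensorTrace_apply]
      rcases hr with hr | hr
      · rw [hr x hn]
        have := hr 1 (one_mem _)
        rw [mul_one] at this
        simp [this]
      · rw [hr x hn]
        have := hr 1 (one_mem _)
        rw [one_mul] at this
        simp [this]
    · exact hD x hx h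
  | algebraMap z =>
    intro p s h
    exact hD _ (D.algebraMap_mem z) h
  | add x y hx' hy' hx hy =>
    intro p s h
    obtain ⟨s₁, h₁, e₁⟩ := hx hx' h
    obtain ⟨s₂, h₂, e₂⟩ := hy hy' h
    refine ⟨s₁ + s₂, ?_, fun r hr => ?_⟩
    · rw [mul_add]
      exact h₁.add h₂
    · rw [LinearMap.add_apply, e₁ r hr, e₂ r hr, add_mul, map_add]
  | mul x y hx' hy' hx hy =>
    intro p s h
    obtain ⟨s₁, h₁, e₁⟩ := hx hx' h
    obtain ⟨s₂, h₂, e₂⟩ := hy hy' h₁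
    refine ⟨s₂, by rwa [← mul_assoc], fun r hr => ?_⟩
    rw [e₂ r, e₁ (y * r), mul_assoc]
    · refine hr.imp_right fun hr m hm => ?_
      rw [← mul_assoc]
      exact hr _ (mul_mem hm hy')
    · refine hr.imp_left fun hr m hm => ?_
      rw [mul_assoc]
      exact hr _ (mul_mem hx' hm)

/-- If the letters `n ∈ N` of a word over `N` and `B` contribute nothing to the derivation of the
word after the prefix `p`, then `τ(j p w) = s(w)`. -/
theorem apply_word {N : Subalgebra ℂ R} (Null : R → R → R → Prop)
    (hN : ∀ n ∈ N, ∀ (p : R) (s : R →ₗ[ℂ] ℂ), IsPartialGradient τ φ A B j p s →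
      ∃ s', IsPartialGradient τ φ A B j (p * n) s' ∧ ∀ r, Null p n r → s' r = s (n * r))
    (w : List (Bool × R)) (hw : ∀ x ∈ w, x.2 ∈ if x.1 then N else B) :
    ∀ {p : R} {s : R →ₗ[ℂ] ℂ}, IsPartialGradient τ φ A B j p s →
      (∀ u n v, w = u ++ (true, n) :: v →
        Null (p * wordProd u) n (wordProd v)) →
      τ (j * p * wordProd w) = s (wordProd w) := by
  induction w with
  | nil =>
    intro p s h _
    simpa using h.apply_one
  | cons x w ih =>
    intro p s h hnull
    have hw' : ∀ y ∈ w, y.2 ∈ if y.1 then N else B :=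
      fun y hy => hw y (List.mem_cons_of_mem _ hy)
    have hx := hw x List.mem_cons_self
    obtain ⟨b, n⟩ := x
    have hstep : ∀ u m v, w = u ++ (true, m) :: v →
        Null (p * n * wordProd u) m (wordProd v) := by
      intro u m v huv
      simpa [mul_assoc] using hnull ((b, n) :: u) m v (by simp [huv])
    cases b with
    | false =>
      have := ih hw' (h.mul_right_mem (by simpa using hx)) hstep
      simpa [mul_assoc] using this
    | true =>
      obtain ⟨s', h', e⟩ := hN n (by simpa using hx) p s h
      have := ih hw' h' hstep
      rw [e _ (by simpa using hnull [] n w rfl)] at this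
      simpa [mul_assoc] using this

end IsPartialGradient

end PartialGradient

section Alternating

variable {R : Type*} [Ring R] [Algebra ℂ R]

theorem IsCondExp.apply_mul_left {D : Subalgebra ℂ R} {E : R →ₗ[ℂ] R} (hE : IsCondExp D E)
    {d : R} (hd : d ∈ D) (x : R) : E (d * x) = d * E x := by
  simpa using hE.2.2 d hd 1 (one_mem _) x

theorem IsCondExp.apply_mul_right {D : Subalgebra ℂ R} {E : R →ₗ[ℂ] R} (hE : IsCondExp D E)
    {d : R} (hd : d ∈ D) (x : R) : E (x * d) = E x * d := by
  simpa using hE.2.2 1 (one_mem _) d hd x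

theorem IsCondExp.apply_mem {D : Subalgebra ℂ R} {E : R →ₗ[ℂ] R} (hE : IsCondExp D E)
    {d : R} (hd : d ∈ D) : E d = d := by
  simpa [hE.1] using hE.apply_mul_left hd 1

theorem IsCondExp.apply_sub_apply {D : Subalgebra ℂ R} {E : R →ₗ[ℂ] R} (hE : IsCondExp D E)
    (x : R) : E (x - E x) = 0 := by
  rw [map_sub, hE.apply_mem (hE.2.1 x), sub_self]

/-- A word whose letters are `E`-centered and come alternately from `N` (tag `true`) and from `B`
(tag `false`). -/
def IsCenteredAlternating (E : R →ₗ[ℂ] R) (N B : Subalgebra ℂ R) (w : List (Bool × R)) : Prop :=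
  (∀ x ∈ w, x.2 ∈ (if x.1 then N else B) ∧ E x.2 = 0) ∧ w.IsChain fun x y => x.1 ≠ y.1

theorem isFreeWithAmalgamation_iff {E : R →ₗ[ℂ] R} {N B : Subalgebra ℂ R} :
    IsFreeWithAmalgamation E (N : Set R) (B : Set R) ↔
      ∀ w, w ≠ [] → IsCenteredAlternating E N B w → E (wordProd w) = 0 := by
  constructor
  · intro h w hne hw
    have := h w.length (List.length_pos_of_ne_nil hne) (fun i => (w.get i).2)
      (fun i => (w.get i).1) (fun i => ?_) (fun i => (hw.1 _ (List.get_mem w i)).2) ?_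
    · rw [← this, wordProd]
      congr 2
      conv_lhs => rw [← List.ofFn_get w, List.map_ofFn]
      rfl
    · have := (hw.1 _ (List.get_mem w i)).1
      split_ifs at this ⊢ <;> exact this
    · intro i hi
      exact List.isChain_iff_getElem.1 hw.2 i hi
  · intro h k hk a f ha hE hf
    have := h (List.ofFn fun i => (f i, a i)) (by simpa using hk.ne') ⟨?_, ?_⟩
    · rw [wordProd, List.map_ofFn] at this
      exact this
    · intro x hx
      obtain ⟨i, rfl⟩ := List.mem_ofFn.1 hx
      refine ⟨?_, hE i⟩
      have := ha i
      dsimp only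
      split_ifs at this ⊢ <;> exact this
    · exact List.isChain_ofFn.2 fun i hi => hf i hi

namespace IsCenteredAlternating

variable {E : R →ₗ[ℂ] R} {N B D : Subalgebra ℂ R} {w : List (Bool × R)} {x y : Bool × R}

theorem tail (h : IsCenteredAlternating E N B (x :: w)) : IsCenteredAlternating E N B w :=
  ⟨fun y hy => h.1 y (List.mem_cons_of_mem _ hy), h.2.tail⟩

theorem left_of_append {v : List (Bool × R)} (h : IsCenteredAlternating E N B (w ++ v)) :
    IsCenteredAlternating E N B w :=
  ⟨fun y hy => h.1 y (List.mem_append_left _ hy), h.2.left_of_append⟩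

theorem right_of_append {v : List (Bool × R)} (h : IsCenteredAlternating E N B (v ++ w)) :
    IsCenteredAlternating E N B w :=
  ⟨fun y hy => h.1 y (List.mem_append_right _ hy), h.2.right_of_append⟩

theorem replace_head (h : IsCenteredAlternating E N B (x :: w)) {y : R}
    (hy : y ∈ if x.1 then N else B) (hEy : E y = 0) :
    IsCenteredAlternating E N B ((x.1, y) :: w) := by
  refine ⟨?_, ?_⟩
  · rintro z (_ | ⟨_, hz⟩)
    exacts [⟨hy, hEy⟩, h.1 z (List.mem_cons_of_mem _ hz)]
  · have := h.2
    rw [List.isChain_cons] at this ⊢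
    exact this

theorem mul_head (hE : IsCondExp D E) (hDN : D ≤ N) (hDB : D ≤ B)
    (h : IsCenteredAlternating E N B (x :: w)) {d : R} (hd : d ∈ D) :
    IsCenteredAlternating E N B ((x.1, d * x.2) :: w) := by
  have hx := h.1 x List.mem_cons_self
  refine h.replace_head ?_ (by rw [hE.apply_mul_left hd, hx.2, mul_zero])
  have := hx.1
  split_ifs at this ⊢
  exacts [mul_mem (hDN hd) this, mul_mem (hDB hd) this]

theorem cons (h : IsCenteredAlternating E N B (x :: w)) {y : R}
    (hy : y ∈ if !x.1 then N else B) (hEy : E y = 0) :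
    IsCenteredAlternating E N B ((!x.1, y) :: x :: w) := by
  refine ⟨?_, ?_⟩
  · rintro z (_ | ⟨_, hz⟩)
    exacts [⟨hy, hEy⟩, h.1 z hz]
  · rw [List.isChain_cons_cons]
    exact ⟨by simp, h.2⟩

theorem singleton {t : Bool} {y : R} (hy : y ∈ if t then N else B) (hEy : E y = 0) :
    IsCenteredAlternating E N B [(t, y)] := by
  refine ⟨?_, List.isChain_singleton _⟩
  intro z hz
  rw [List.mem_singleton] at hz
  subst hz
  exact ⟨hy, hEy⟩

end IsCenteredAlternating

/-- The span of `D` and of the alternating centered words. -/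
def alternatingSpan (E : R →ₗ[ℂ] R) (N B D : Subalgebra ℂ R) : Submodule ℂ R :=
  Submodule.span ℂ {x | x ∈ D ∨ ∃ w, w ≠ [] ∧ IsCenteredAlternating E N B w ∧ wordProd w = x}

theorem mul_mem_alternatingSpan {E : R →ₗ[ℂ] R} {N B D : Subalgebra ℂ R} (hE : IsCondExp D E)
    (hDN : D ≤ N) (hDB : D ≤ B) {t : Bool} {m : R} (hm : m ∈ if t then N else B) {y : R}
    (hy : y ∈ alternatingSpan E N B D) : m * y ∈ alternatingSpan E N B D := by
  have hDt : ∀ t : Bool, D ≤ if t then N else B := by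
    intro t
    split_ifs
    exacts [hDN, hDB]
  have hdec : ∀ m, m - E m + E m = m := fun m => sub_add_cancel m (E m)
  have hDmem : ∀ d ∈ D, d ∈ alternatingSpan E N B D := fun d hd =>
    Submodule.subset_span (Or.inl hd)
  have hword : ∀ w, w ≠ [] → IsCenteredAlternating E N B w →
      wordProd w ∈ alternatingSpan E N B D := fun w hne hw =>
    Submodule.subset_span (Or.inr ⟨w, hne, hw, rfl⟩)
  have habsorb : ∀ w d, d ∈ D → IsCenteredAlternating E N B w →
      d * wordProd w ∈ alternatingSpan E N B D := by
    intro w d hd hw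
    cases w with
    | nil => simpa using hDmem d hd
    | cons x w =>
      have := hword _ (List.cons_ne_nil _ _) (hw.mul_head hE hDN hDB hd)
      simpa [mul_assoc] using this
  induction hy using Submodule.span_induction with
  | zero => simp
  | add x y _ _ hx hy => rw [mul_add]; exact add_mem hx hy
  | smul z x _ hx => rw [mul_smul_comm]; exact Submodule.smul_mem _ _ hx
  | mem y hy =>
    have hcen : ∀ a ∈ (if t then N else B), a - E a ∈ if t then N else B := fun a ha =>
      sub_mem ha (hDt t (hE.2.1 a))
    rcases hy with hy | ⟨w, hne, hw, rfl⟩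
    · have hmy := mul_mem hm (hDt t hy)
      rw [← hdec (m * y)]
      refine add_mem ?_ (hDmem _ (hE.2.1 _))
      simpa using hword [(t, m * y - E (m * y))] (by simp)
        (.singleton (hcen _ hmy) (hE.apply_sub_apply _))
    · obtain _ | ⟨⟨b, x⟩, w⟩ := w
      · exact absurd rfl hne
      by_cases hb : b = t
      · subst hb
        have hmx := mul_mem hm (hw.1 _ List.mem_cons_self).1
        rw [wordProd_cons, ← mul_assoc, ← hdec (m * x), add_mul]
        refine add_mem ?_ (habsorb _ _ (hE.2.1 _) hw.tail)
        simpa using hword _ (List.cons_ne_nil _ _)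
          (hw.replace_head (hcen _ hmx) (hE.apply_sub_apply _))
      · have hbt : (!b) = t := by cases b <;> cases t <;> simp_all
        subst hbt
        rw [← hdec m, add_mul]
        refine add_mem ?_ (habsorb _ _ (hE.2.1 _) hw)
        simpa using hword _ (List.cons_ne_nil _ _)
          (hw.cons (hcen _ hm) (hE.apply_sub_apply _))

theorem sup_le_alternatingSpan {E : R →ₗ[ℂ] R} {N B D : Subalgebra ℂ R} (hE : IsCondExp D E)
    (hDN : D ≤ N) (hDB : D ≤ B) {x : R} (hx : x ∈ N ⊔ B) : x ∈ alternatingSpan E N B D := by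
  suffices ∀ y ∈ alternatingSpan E N B D, x * y ∈ alternatingSpan E N B D by
    simpa using this 1 (Submodule.subset_span (Or.inl (one_mem _)))
  rw [Algebra.sup_def] at hx
  induction hx using Algebra.adjoin_induction with
  | mem x hx =>
    intro y hy
    rcases hx with hx | hx
    · exact mul_mem_alternatingSpan (t := true) hE hDN hDB (by simpa using hx) hy
    · exact mul_mem_alternatingSpan (t := false) hE hDN hDB (by simpa using hx) hy
  | algebraMap z =>
    intro y hy
    rw [← Algebra.smul_def]
    exact Submodule.smul_mem _ _ hy
  | add a b _ _ ha hb =>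
    intro y hy
    rw [add_mul]
    exact add_mem (ha y hy) (hb y hy)
  | mul a b _ _ ha hb =>
    intro y hy
    rw [mul_assoc]
    exact ha _ (hb y hy)

/-- Under freeness with amalgamation, an alternating centered word containing a letter of `B` is
orthogonal to `N`. -/
theorem IsFreeWithAmalgamation.trace_mul_wordProd {τ : R →ₗ[ℂ] ℂ} {E : R →ₗ[ℂ] R}
    {N B D : Subalgebra ℂ R} (hfree : IsFreeWithAmalgamation E (N : Set R) (B : Set R))
    (hE : IsCondExp D E) (hEτ : ∀ x, τ (E x) = τ x) (hDN : D ≤ N) {w : List (Bool × R)}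
    (hw : IsCenteredAlternating E N B w) (hB : ∃ x ∈ w, x.1 = false) {n : R} (hn : n ∈ N) :
    τ (n * wordProd w) = 0 := by
  rw [isFreeWithAmalgamation_iff] at hfree
  have key : ∀ b v, IsCenteredAlternating E N B ((false, b) :: v) → ∀ m ∈ N,
      τ (m * wordProd ((false, b) :: v)) = 0 := by
    intro b v hv m hm
    have h₁ := hfree _ (List.cons_ne_nil _ _)
      (hv.cons (y := m - E m) (by simpa using sub_mem hm (hDN (hE.2.1 m)))
        (hE.apply_sub_apply m))
    have h₂ := hfree _ (List.cons_ne_nil _ _) hv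
    rw [wordProd_cons] at h₁
    rw [← sub_add_cancel m (E m), add_mul, map_add, ← hEτ, h₁, ← hEτ (E m * _),
      hE.apply_mul_left (hE.2.1 m), h₂]
    simp
  match w, hw, hB with
  | (false, b) :: v, hw, _ => exact key b v hw n hn
  | [(true, x)], _, hB => simp at hB
  | (true, x) :: (false, b) :: v, hw, _ =>
    have hx : x ∈ N := by simpa using (hw.1 _ List.mem_cons_self).1
    rw [wordProd_cons, ← mul_assoc]
    exact key b v hw.tail _ (mul_mem hn hx)
  | (true, x) :: (true, b) :: v, hw, _ =>
    exact absurd rfl (List.isChain_cons_cons.1 hw.2).1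

end Alternating

section Trace

/-- A finite-dimensional `*`-subalgebra has a pair of bases dual to each other under the trace. -/
theorem IsFaithfulTracialState.exists_dual_frame {R : Type*} [Ring R] [Algebra ℂ R] [StarRing R]
    {τ : R →ₗ[ℂ] ℂ} (hτ : IsFaithfulTracialState τ) (D : Subalgebra ℂ R)
    [FiniteDimensional ℂ D] (hDstar : ∀ d ∈ D, star d ∈ D) :
    ∃ (n : ℕ) (e f : Fin n → R), (∀ i, e i ∈ D) ∧ (∀ i, f i ∈ D) ∧
      ∀ d ∈ D, ∑ i, τ (d * e i) • f i = d := by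
  let β : LinearMap.BilinForm ℂ D :=
    (LinearMap.mul ℂ D).compr₂ (τ ∘ₗ D.val.toLinearMap)
  have hβ : ∀ x y : D, β x y = τ (x * y) := fun x y => rfl
  have hsymm : β.IsSymm := ⟨fun x y => by simp [hβ, hτ.tracial (x : R)]⟩
  have hnd : β.Nondegenerate := by
    refine (LinearMap.IsRefl.nondegenerate_iff_separatingLeft hsymm.isRefl).2 fun x hx => ?_
    have := hx ⟨star (x : R), hDstar _ x.2⟩
    rw [hβ, hτ.tracial] at this
    exact Subtype.ext (hτ.faithful _ this)
  let b := Module.finBasis ℂ D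
  refine ⟨_, fun i => b i, fun i => β.dualBasis hnd b i, fun i => (b i).2,
    fun i => (β.dualBasis hnd b i).2, fun d hd => ?_⟩
  have := congrArg (Subtype.val) ((β.dualBasis hnd b).sum_repr ⟨d, hd⟩)
  simpa [LinearMap.BilinForm.dualBasis_repr_apply, hβ] using this

theorem adjoin_union_star_image {R : Type*} [Ring R] [Algebra ℂ R] [StarRing R]
    {A B : Subalgebra ℂ R} (hA : ∀ a ∈ A, star a ∈ A)
    (hB : ∀ b ∈ B, star b ∈ B) :
    Algebra.adjoin ℂ ((A : Set R) ∪ B ∪ star '' ((A : Set R) ∪ B)) = A ⊔ B := by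
  rw [Algebra.sup_def]
  congr 1
  rw [Set.union_eq_left]
  rintro _ ⟨x, hx | hx, rfl⟩
  exacts [Or.inl (hA x hx), Or.inr (hB x hx)]

namespace IsFaithfulTracialState

variable {τ : M →ₗ[ℂ] ℂ}

theorem apply_star (hτ : IsFaithfulTracialState τ) (x : M) :
    τ (star x) = (starRingEnd ℂ) (τ x) := by
  have h₁ := (hτ.pos (1 + x)).2
  have h₂ := (hτ.pos (1 + Complex.I • x)).2
  have h₃ := (hτ.pos x).2
  simp only [star_add, star_one, star_smul, add_mul, mul_add, one_mul, mul_one, map_add,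
    hτ.unital, smul_mul_assoc, mul_smul_comm, map_smul, smul_eq_mul] at h₁ h₂
  simp [h₃] at h₁ h₂
  apply Complex.ext
  · rw [Complex.conj_re]
    linarith
  · rw [Complex.conj_im]
    linarith

/-- An element `k` orthogonal to the algebra generated by `S` is orthogonal to `L²(S)`. -/
theorem apply_mul_eq_zero_of_memL2Closure (hτ : IsFaithfulTracialState τ) {S : Set M} {j k : M}
    (hj : MemL2Closure τ S j)
    (hk : ∀ a ∈ Algebra.adjoin ℂ (S ∪ star '' S), τ (k * a) = 0) : τ (k * j) = 0 := by
  by_contra hne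
  set β := τ (k * j) with hβ
  have hb : 0 < Complex.normSq β := Complex.normSq_pos.2 hne
  set C := (τ (k * star k)).re with hC
  have hC0 : 0 ≤ C := by simpa using (hτ.pos (star k)).1
  obtain ⟨a, ha, hlt⟩ := hj (Real.sqrt (Complex.normSq β) / (C + 1)) (by positivity)
  set y := j - a with hy
  have hky : τ (k * y) = β := by rw [hy, mul_sub, map_sub, hk a ha, sub_zero]
  have hyk : τ (star y * star k) = (starRingEnd ℂ) β := by
    rw [← star_mul, hτ.apply_star, hky]
  have hq : (τ (star y * y)).re < Complex.normSq β / (C + 1) ^ 2 := by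
    rw [l2Dist, ← hτ.tracial, Real.sqrt_lt' (by positivity), div_pow,
      Real.sq_sqrt hb.le] at hlt
    exact hlt
  have hq0 := (hτ.pos y).2
  set t : ℝ := (C + 1) / Complex.normSq β with ht
  have hpos := (hτ.pos (star k - ((t : ℂ) * (starRingEnd ℂ) β) • y)).1
  have hexp : (τ (star (star k - ((t : ℂ) * (starRingEnd ℂ) β) • y) *
      (star k - ((t : ℂ) * (starRingEnd ℂ) β) • y))).re =
      C - 2 * t * Complex.normSq β + t ^ 2 * Complex.normSq β * (τ (star y * y)).re := by
    simp only [star_sub, star_star, star_smul, sub_mul, mul_sub, smul_mul_assoc, mul_smul_comm,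
      map_sub, map_smul, hky, hyk, smul_eq_mul]
    simp [hq0, Complex.normSq_apply, ← hC]
    ring
  rw [hexp] at hpos
  have h₁ : t * Complex.normSq β = C + 1 := div_mul_cancel₀ _ hb.ne'
  have h₂ : t ^ 2 * Complex.normSq β * (τ (star y * y)).re < 1 := by
    have ht0 : 0 < t := by positivity
    calc t ^ 2 * Complex.normSq β * (τ (star y * y)).re
        < t ^ 2 * Complex.normSq β * (Complex.normSq β / (C + 1) ^ 2) := by gcongr
      _ = (t * Complex.normSq β) ^ 2 / (C + 1) ^ 2 := by ring
      _ = 1 := by rw [h₁]; exact div_self (by positivity)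
  nlinarith

end IsFaithfulTracialState

theorem star_mem_sup {A B : Subalgebra ℂ M} (hA : ∀ a ∈ A, star a ∈ A)
    (hB : ∀ b ∈ B, star b ∈ B) {x : M} (hx : x ∈ A ⊔ B) : star x ∈ A ⊔ B := by
  rw [Algebra.sup_def] at hx ⊢
  induction hx using Algebra.adjoin_induction with
  | mem x hx =>
    apply Algebra.subset_adjoin
    rcases hx with hx | hx
    exacts [Or.inl (hA x hx), Or.inr (hB x hx)]
  | algebraMap z =>
    rw [Algebra.algebraMap_eq_smul_one, star_smul, star_one]
    exact Subalgebra.smul_mem _ (one_mem _) _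
  | add a b _ _ ha hb => rw [star_add]; exact add_mem ha hb
  | mul a b _ _ ha hb => rw [star_mul]; exact mul_mem hb ha

end Trace

section ConditionalForm

variable {R : Type*} [Ring R] [Algebra ℂ R]

/-- The bilinear form `(u, v) ↦ τ(u E(v))`. -/
def condTrace (τ : R →ₗ[ℂ] ℂ) (E : R →ₗ[ℂ] R) : R →ₗ[ℂ] R →ₗ[ℂ] ℂ :=
  ((LinearMap.mul ℂ R).compr₂ τ).compl₂ E

@[simp]
theorem condTrace_apply (τ : R →ₗ[ℂ] ℂ) (E : R →ₗ[ℂ] R) (u v : R) :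
    condTrace τ E u v = τ (u * E v) := rfl

theorem freeDifference_append_one (φ : R →ₗ[ℂ] R →ₗ[ℂ] ℂ) (e f : R) (w : List (R × R)) :
    ∀ p, freeDifference φ (f * p) (w ++ [(1, e)]) =
      freeDifference (φ.compl₁₂ (LinearMap.mulLeft ℂ f) (LinearMap.mulRight ℂ e)) p w := by
  induction w with
  | nil => simp [freeDifference]
  | cons x w ih =>
    intro p
    simp only [List.cons_append, freeDifference, ← ih, pairProd_append, pairProd_cons, pairProd_nil,
      LinearMap.compl₁₂_apply, LinearMap.mulLeft_apply, LinearMap.mulRight_apply, mul_one, one_mul,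
      mul_assoc]

theorem sum_freeDifference {ι : Type*} (I : Finset ι) (φ : ι → R →ₗ[ℂ] R →ₗ[ℂ] ℂ)
    (w : List (R × R)) :
    ∀ p, ∑ i ∈ I, freeDifference (φ i) p w = freeDifference (∑ i ∈ I, φ i) p w := by
  induction w with
  | nil => simp [freeDifference]
  | cons x w ih =>
    intro p
    simp only [freeDifference, Finset.sum_add_distrib, Finset.sum_sub_distrib, ih,
      LinearMap.sum_apply]

/-- Averaging a scalar-valued liberation gradient over dual bases of `D` gives the gradient
relative to `D`. -/
theorem IsPartialGradient.average {τ : R →ₗ[ℂ] ℂ} {E : R →ₗ[ℂ] R} {A B D : Subalgebra ℂ R} {j : R}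
    (hτ : ∀ x y, τ (x * y) = τ (y * x)) (hE : IsCondExp D E) (hEτ : ∀ x, τ (E x) = τ x)
    (hDB : D ≤ B) {n : ℕ} {e f : Fin n → R} (he : ∀ i, e i ∈ D) (hf : ∀ i, f i ∈ D)
    (hef : ∀ d ∈ D, ∑ i, τ (d * e i) • f i = d)
    (hj : IsPartialGradient τ (tensorTrace τ) A B j 1 0) :
    IsPartialGradient τ (condTrace τ E) A B (∑ i, e i * j * f i) 1 0 := by
  have hφ : ∑ i, (tensorTrace τ).compl₁₂ (LinearMap.mulLeft ℂ (f i)) (LinearMap.mulRight ℂ (e i)) =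
      condTrace τ E := by
    ext u v
    simp only [LinearMap.sum_apply, LinearMap.compl₁₂_apply, tensorTrace_apply,
      LinearMap.mulLeft_apply, LinearMap.mulRight_apply, condTrace_apply]
    rw [hτ u, ← hef _ (hE.2.1 v), Finset.sum_mul, map_sum]
    refine Finset.sum_congr rfl fun i _ => ?_
    rw [smul_mul_assoc, map_smul, smul_eq_mul, ← hE.apply_mul_right (he i), hEτ, mul_comm]
  intro w hw
  rw [← hφ, ← sum_freeDifference, mul_one, LinearMap.zero_apply, zero_add, Finset.sum_mul, map_sum]
  refine Finset.sum_congr rfl fun i _ => ?_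
  have := hj.mul_right_mem (hDB (hf i)) (w ++ [(1, e i)]) (by
    intro x hx
    rcases List.mem_append.1 hx with hx | hx
    · exact hw x hx
    · rw [List.mem_singleton] at hx
      subst hx
      exact ⟨one_mem _, hDB (he i)⟩)
  have hfi := freeDifference_append_one (tensorTrace τ) (e i) (f i) w 1
  rw [mul_one] at hfi
  rw [← hfi]
  simp only [pairProd_append, pairProd_cons, pairProd_nil, one_mul, mul_one, LinearMap.zero_comp,
    LinearMap.zero_apply, zero_add] at this
  rw [← this, mul_assoc, mul_assoc, hτ, mul_assoc, mul_assoc, mul_assoc]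

theorem condTrace_balanced {τ : R →ₗ[ℂ] ℂ} {E : R →ₗ[ℂ] R} {D : Subalgebra ℂ R}
    (hE : IsCondExp D E) : ∀ d ∈ D, ∀ u v, condTrace τ E (u * d) v = condTrace τ E u (d * v) := by
  intro d hd u v
  rw [condTrace_apply, condTrace_apply, hE.apply_mul_left hd, mul_assoc]

/-- If the liberation gradient relative to `D` vanishes, then `A ∨ D` is free from `B` with
amalgamation over `D`. -/
theorem IsPartialGradient.isFreeWithAmalgamation {τ : R →ₗ[ℂ] ℂ} {E : R →ₗ[ℂ] R}
    {A B D : Subalgebra ℂ R} (hτ : ∀ x y, τ (x * y) = τ (y * x))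
    (hτE : ∀ x, (∀ d ∈ D, τ (x * d) = 0) → E x = 0)
    (hE : IsCondExp D E) (hEτ : ∀ x, τ (E x) = τ x) (hDB : D ≤ B)
    (hj : IsPartialGradient τ (condTrace τ E) A B 0 1 0) :
    IsFreeWithAmalgamation E ((A ⊔ D : Subalgebra ℂ R) : Set R) (B : Set R) := by
  set N := A ⊔ D with hNdef
  have hDN : D ≤ N := le_sup_right
  have hDt : ∀ t : Bool, D ≤ if t then N else B := by
    intro t
    split_ifs
    exacts [hDN, hDB]
  have hform : ∀ u v, condTrace τ E u v = τ (E u * E v) := fun u v => by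
    rw [condTrace_apply, ← hEτ, hE.apply_mul_right (hE.2.1 v)]
  rw [isFreeWithAmalgamation_iff]
  suffices ∀ k, ∀ w : List (Bool × R), w.length = k → w ≠ [] → IsCenteredAlternating E N B w →
      E (wordProd w) = 0 from fun w => this _ w rfl
  intro k
  induction k using Nat.strong_induction_on with
  | _ k ih =>
  -- words starting in `N` and ending in `B`
  have hNB : ∀ (n : R) (v : List (Bool × R)) (b : R), v.length + 2 = k →
      IsCenteredAlternating E N B ((true, n) :: (v ++ [(false, b)])) →
      τ (wordProd ((true, n) :: (v ++ [(false, b)]))) = 0 := by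
    intro n v b hk hw
    have hn := hw.1 _ List.mem_cons_self
    have hn1 : n ∈ N := by simpa using hn.1
    have hn2 : E n = 0 := hn.2
    have key := IsPartialGradient.apply_word (φ := condTrace τ E) (N := N) (B := B)
      (Null := fun p n r => condTrace τ E (p * n) r = condTrace τ E p (n * r))
      (fun n hn p s h => ⟨_, h.mul_sup_mem hDB (condTrace_balanced hE) hn, fun r hr => by
        simp only [LinearMap.sub_apply, LinearMap.add_apply, LinearMap.comp_apply,
          LinearMap.mulLeft_apply, hr]
        ring⟩)
      (v ++ [(false, b)]) (fun x hx => (hw.tail.1 x hx).1)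
      (hj.mul_sup_mem hDB (condTrace_balanced hE) hn1) (by
        intro u m r hur
        rw [hform, hform]
        have hr : r ≠ [] := by
          rintro rfl
          have := congrArg List.getLast? hur
          simp at this
        have hlen := congrArg List.length hur
        have hr' := List.length_pos_of_ne_nil hr
        simp only [List.length_append, List.length_cons, List.length_nil] at hlen
        have e₁ : E (wordProd ((true, n) :: u)) = 0 := by
          refine ih _ (by simp only [List.length_cons]; omega) _ rfl (by simp) ?_
          rw [hur, ← List.cons_append] at hw
          exact hw.left_of_append
        have e₂ : E (wordProd ((true, n) :: (u ++ [(true, m)]))) = 0 := by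
          refine ih _ (by simp only [List.length_cons, List.length_append]; simp; omega) _ rfl
            (by simp) ?_
          rw [hur, List.append_cons, ← List.cons_append] at hw
          exact hw.left_of_append
        simp only [wordProd_cons, wordProd_append, wordProd_nil, mul_one] at e₁ e₂
        rw [one_mul, mul_assoc, e₁, e₂, zero_mul, zero_mul])
    simp only [zero_mul, map_zero, LinearMap.zero_comp, zero_add, one_mul, LinearMap.sub_apply,
      LinearMap.comp_apply, LinearMap.mulLeft_apply, hform, hE.1, hn2, zero_sub, hEτ] at key
    rw [wordProd_cons]
    exact neg_eq_zero.1 key.symm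
  have htr : ∀ w : List (Bool × R), w.length = k → w ≠ [] → IsCenteredAlternating E N B w →
      τ (wordProd w) = 0 := by
    intro w hk hne hw
    obtain _ | ⟨⟨s, x⟩, w⟩ := w
    · exact absurd rfl hne
    obtain rfl | ⟨v, ⟨t, y⟩, rfl⟩ := List.eq_nil_or_concat' w
    · have := (hw.1 _ List.mem_cons_self).2
      rw [← hEτ]
      simp [this]
    have hx := hw.1 (s, x) List.mem_cons_self
    have hy := hw.1 (t, y) (by simp)
    simp only [List.length_cons, List.length_append, List.length_nil] at hk
    have hrot : τ (wordProd ((s, x) :: (v ++ [(t, y)]))) = τ (wordProd ((t, y) :: (s, x) :: v)) := by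
      simp only [wordProd_cons, wordProd_append, wordProd_nil, mul_one]
      rw [← mul_assoc, hτ]
    by_cases hst : s = t
    · subst hst
      have hv : v ≠ [] := by
        rintro rfl
        exact (List.isChain_cons_cons.1 hw.2).1 rfl
      have hsv : IsCenteredAlternating E N B ((s, x) :: v) := by
        rw [← List.cons_append] at hw
        exact hw.left_of_append
      have hyx := mul_mem hy.1 hx.1
      rw [hrot, wordProd_cons, wordProd_cons, ← mul_assoc]
      dsimp only at hyx ⊢
      have h₁ := ih (v.length + 1) (by omega) _ (by simp) (List.cons_ne_nil _ _)
        (hsv.replace_head (sub_mem hyx (hDt _ (hE.2.1 (y * x)))) (hE.apply_sub_apply (y * x)))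
      have h₂ := ih v.length (by omega) _ rfl hv hsv.tail
      rw [wordProd_cons] at h₁
      rw [← sub_add_cancel (y * x) (E (y * x)), add_mul, map_add, ← hEτ, h₁, ← hEτ (_ * _),
        hE.apply_mul_left (hE.2.1 _), h₂]
      simp
    · cases s with
      | true =>
        obtain rfl : t = false := by simpa using Ne.symm hst
        exact hNB x v y (by omega) hw
      | false =>
        obtain rfl : t = true := by simpa using Ne.symm hst
        have hsv : IsCenteredAlternating E N B ((false, x) :: v) := by
          rw [← List.cons_append] at hw
          exact hw.left_of_append
        have hrw := hsv.cons (y := y) (by simpa using hy.1) hy.2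
        rw [hrot]
        obtain rfl | ⟨u, ⟨t, z⟩, rfl⟩ := List.eq_nil_or_concat' v
        · exact hNB y [] x (by simpa using hk) hrw
        · cases t with
          | true =>
            have := hw.2
            rw [List.append_assoc, ← List.cons_append] at this
            have := this.right_of_append
            exact absurd rfl (List.isChain_cons_cons.1 this).1
          | false =>
            exact hNB y ((false, x) :: u) z (by simp at hk ⊢; omega) hrw
  intro w hk hne hw
  refine hτE _ fun d hd => ?_
  obtain rfl | ⟨v, ⟨t, y⟩, rfl⟩ := List.eq_nil_or_concat' w
  · exact absurd rfl hne
  have hy := hw.1 (t, y) (by simp)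
  have := htr (v ++ [(t, y * d)]) (by simpa using hk) (by simp) ⟨?_, ?_⟩
  · simpa [mul_assoc] using this
  · intro x hx
    rcases List.mem_append.1 hx with hx | hx
    · exact hw.1 x (List.mem_append_left _ hx)
    · rw [List.mem_singleton] at hx
      subst hx
      exact ⟨mul_mem hy.1 (hDt t hd), by rw [hE.apply_mul_right hd, hy.2, zero_mul]⟩
  · have := hw.2
    rw [List.isChain_append] at this ⊢
    exact ⟨this.1, List.isChain_singleton _, by simpa using this.2.2⟩

end ConditionalForm

theorem scalar_liberation_gradients_equal_iff_free
    (τ : M →ₗ[ℂ] ℂ) (hτ : IsFaithfulTracialState τ)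
    (A B : Subalgebra ℂ M)
    (hAstar : ∀ a ∈ A, star a ∈ A) (hBstar : ∀ b ∈ B, star b ∈ B)
    (halgfree : AlgebraicallyFreeModulo ⊥ A B bot_le bot_le)
    (D : Subalgebra ℂ M) (hDB : D ≤ B) [FiniteDimensional ℂ ↥D]
    (hDstar : ∀ d ∈ D, star d ∈ D)
    (ED : M →ₗ[ℂ] M) (hED : IsCondExp D ED) (hEDτ : ∀ x, τ (ED x) = τ x)
    (jB : M) (hjB : IsLiberationGradient τ τ (A : Set M) (B : Set M) jB) :
    (IsLiberationGradient τ τ (A : Set M) (D : Set M) jB ↔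
      IsFreeWithAmalgamation ED ((A ⊔ D : Subalgebra ℂ M) : Set M) (B : Set M)) := by
  have hτE : ∀ x, (∀ d ∈ D, τ (x * d) = 0) → ED x = 0 := by
    intro x hx
    refine hτ.faithful _ ?_
    have hd := hDstar _ (hED.2.1 x)
    rw [hτ.tracial, ← hED.apply_mul_right hd, hEDτ, hx _ hd]
  have hrep := hjB.2.isPartialGradient
  constructor
  · rintro ⟨hmem, -⟩
    obtain ⟨n, e, f, he, hf, hef⟩ := hτ.exists_dual_frame D hDstar
    have hJ := hrep.average hτ.tracial hED hEDτ hDB he hf hef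
    set J := ∑ i, e i * jB * f i with hJdef
    have hJN : ∀ m ∈ A ⊔ D, τ (J * m) = 0 := by
      intro m hm
      have := (hJ.mul_sup_mem hDB (condTrace_balanced hED) hm).apply_one
      simpa [hED.1, hEDτ] using this
    have hJ0 : J = 0 := by
      refine hτ.faithful _ ?_
      nth_rewrite 2 [hJdef]
      rw [Finset.mul_sum, map_sum]
      refine Finset.sum_eq_zero fun i _ => ?_
      rw [← mul_assoc, hτ.tracial, ← mul_assoc, ← mul_assoc]
      refine hτ.apply_mul_eq_zero_of_memL2Closure hmem fun a ha => ?_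
      rw [adjoin_union_star_image hAstar hDstar] at ha
      have hm : e i * a * f i ∈ A ⊔ D :=
        mul_mem (mul_mem (le_sup_right (a := A) (he i)) ha) (le_sup_right (a := A) (hf i))
      have : f i * star J * e i * a = f i * (star J * (e i * a)) := by simp only [mul_assoc]
      rw [this, hτ.tracial, mul_assoc, ← star_star (e i * a * f i), ← star_mul, hτ.apply_star,
        hτ.tracial, hJN _ (star_mem_sup hAstar hDstar hm), map_zero]
    rw [hJ0] at hJ
    exact hJ.isFreeWithAmalgamation hτ.tracial hτE hED hEDτ hDB
  · intro hfree
    refine ⟨?_, fun m c c' hc hc' => hjB.2 m c c' hc fun r => hDB (hc' r)⟩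
    have hDN : D ≤ A ⊔ D := le_sup_right
    -- alternating centered words with a letter in `B` are orthogonal to `A ∨ D` and to `jB`
    have hword : ∀ w, IsCenteredAlternating ED (A ⊔ D) B w → (∃ x ∈ w, x.1 = false) →
        τ (jB * wordProd w) = 0 := by
      intro w hw hB
      have := IsPartialGradient.apply_word (N := A ⊔ D)
        (fun p _ r => (∀ m ∈ A ⊔ D, τ (p * m) = 0) ∨ ∀ m ∈ A ⊔ D, τ (m * r) = 0)
        (fun n hn p s h => h.exists_mul_sup_mem hDB hn) w (fun x hx => (hw.1 x hx).1) hrep ?_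
      · simpa using this
      · rintro u n v rfl
        obtain ⟨x, hx, hxB⟩ := hB
        rcases List.mem_append.1 hx with hx | hx
        · left
          intro m hm
          rw [one_mul, hτ.tracial]
          exact hfree.trace_mul_wordProd hED hEDτ hDN hw.left_of_append ⟨x, hx, hxB⟩ hm
        · right
          intro m hm
          have hxv : x ∈ v := by
            rcases List.mem_cons.1 hx with rfl | hx
            · cases hxB
            · exact hx
          exact hfree.trace_mul_wordProd hED hEDτ hDN hw.right_of_append.tail ⟨x, hxv, hxB⟩ hm
    have hdecomp : ∀ y ∈ alternatingSpan ED (A ⊔ D) B D, ∃ n ∈ A ⊔ D, ∃ z, n + z = y ∧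
        τ (jB * z) = 0 ∧ ∀ m ∈ A ⊔ D, τ (m * z) = 0 := by
      intro y hy
      induction hy using Submodule.span_induction with
      | zero => exact ⟨0, zero_mem _, 0, by simp⟩
      | add a b _ _ ha hb =>
        obtain ⟨n, hn, z, rfl, h₁, h₂⟩ := ha
        obtain ⟨n', hn', z', rfl, h₁', h₂'⟩ := hb
        refine ⟨n + n', add_mem hn hn', z + z', by abel, ?_, fun m hm => ?_⟩
        · rw [mul_add, map_add, h₁, h₁', add_zero]
        · rw [mul_add, map_add, h₂ m hm, h₂' m hm, add_zero]
      | smul c a _ ha =>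
        obtain ⟨n, hn, z, rfl, h₁, h₂⟩ := ha
        refine ⟨c • n, Subalgebra.smul_mem _ hn c, c • z, by rw [smul_add], ?_, fun m hm => ?_⟩
        · rw [mul_smul_comm, map_smul, h₁, smul_zero]
        · rw [mul_smul_comm, map_smul, h₂ m hm, smul_zero]
      | mem y hy =>
        rcases hy with hy | ⟨w, -, hw, rfl⟩
        · exact ⟨y, hDN hy, 0, by simp⟩
        · by_cases hB : ∃ x ∈ w, x.1 = false
          · exact ⟨0, zero_mem _, wordProd w, zero_add _, hword w hw hB, fun m hm =>
              hfree.trace_mul_wordProd hED hEDτ hDN hw hB hm⟩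
          · push Not at hB
            refine ⟨wordProd w, Subalgebra.list_prod_mem _ fun y hy => ?_, 0, by simp⟩
            obtain ⟨x, hx, rfl⟩ := List.mem_map.1 hy
            have := (hw.1 x hx).1
            rwa [if_pos (by simpa using hB x hx)] at this
    intro ε hε
    obtain ⟨x, hx, hlt⟩ := hjB.1 ε hε
    rw [adjoin_union_star_image hAstar hBstar] at hx
    have hx' : star x ∈ (A ⊔ D) ⊔ B :=
      sup_le_sup_right (le_sup_left (a := A) (b := D)) B (star_mem_sup hAstar hBstar hx)
    obtain ⟨n, hn, z, hnz, hz₁, hz₂⟩ := hdecomp _ (sup_le_alternatingSpan hED hDN hDB hx')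
    refine ⟨star n, ?_, lt_of_le_of_lt ?_ hlt⟩
    · rw [adjoin_union_star_image hAstar hDstar]
      exact star_mem_sup hAstar hDstar hn
    · have hxe : x = star n + star z := by rw [← star_add, hnz, star_star]
      have hperp : τ ((jB - star n) * z) = 0 := by
        rw [sub_mul, map_sub, hz₁, hz₂ _ (star_mem_sup hAstar hDstar hn), sub_zero]
      have hperp' : τ (star z * star (jB - star n)) = 0 := by
        rw [← star_mul, hτ.apply_star, hperp, map_zero]
      refine Real.sqrt_le_sqrt ?_
      have hsub : jB - x = (jB - star n) - star z := by rw [hxe]; abel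
      rw [hsub]
      generalize jB - star n = v at hperp hperp' ⊢
      rw [star_sub, star_star, sub_mul, mul_sub, mul_sub, map_sub, map_sub, map_sub,
        hperp, hperp', hτ.tracial (star z) z]
      have := (hτ.pos (star z)).1
      rw [star_star] at this
      simpa using this

end OVD
end
end

section
/- Let (M, τ) be a tracial W*-probability space, B ⊂ M a unital *-subalgebra, and X_1,…,X_n ∈ M selfadjoint with Φ*(X_1,…,X_n : B) < ∞. Let D ⊂ B be a finite-dimensional unital *-subalgebra of B with a conditional expectation E: M → D such that τ∘E = τ. Then the following are equivalent: (i) Φ*(X_1,…,X_n : D) = Φ*(X_1,…,X_n : B); (ii) {X_1,…,X_n} is free from B with amalgamation over D. -/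
/-!  Statement 17 (Theorem 6.2, second main result):  for finite-dimensional `D ⊆ B` and selfadjoint `X₁,…,Xₙ` with `Φ*(X₁,…,Xₙ : B) < ∞`, one has `Φ*(X₁,…,Xₙ : D) = Φ*(X₁,…,Xₙ : B)` iff `{X₁,…,Xₙ}` is free from `B` with amalgamation over `D`. -/

open scoped Classical ENNReal

noncomputable section

namespace OVD

variable {M : Type*} [Ring M] [Algebra ℂ M] [StarRing M] [StarModule ℂ M]

/-- the word `b₁ X_{i₁} b₂ X_{i₂} ⋯ b_m X_{i_m} b_{m+1}`. -/
def altWord {n : ℕ} (X : Fin n → M) {m : ℕ} (b : Fin (m + 1) → M)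
    (idx : Fin m → Fin n) : M :=
  (List.ofFn fun j : Fin m => b j.castSucc * X (idx j)).prod * b (Fin.last m)

/-- the initial segment `b₁ X_{i₁} ⋯ b_{r-1} X_{i_{r-1}} b_r` of an
alternating word (`r` is `0`-indexed). -/
def altWordBefore {n : ℕ} (X : Fin n → M) {m : ℕ} (b : Fin (m + 1) → M)
    (idx : Fin m → Fin n) (r : Fin m) : M :=
  (((List.finRange m).filter fun s : Fin m => decide ((s : ℕ) < (r : ℕ))).map
      fun j => b j.castSucc * X (idx j)).prod * b r.castSucc

/-- the final segment `b_{r+1} X_{i_{r+1}} ⋯ b_m X_{i_m} b_{m+1}` of an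
alternating word (`r` is `0`-indexed). -/
def altWordAfter {n : ℕ} (X : Fin n → M) {m : ℕ} (b : Fin (m + 1) → M)
    (idx : Fin m → Fin n) (r : Fin m) : M :=
  (((List.finRange m).filter fun s : Fin m => decide ((r : ℕ) < (s : ℕ))).map
      fun j => b j.castSucc * X (idx j)).prod * b (Fin.last m)

/-- the defining equations of the conjugate variables `J_i = J_i(X₁,…,Xₙ : B)`:
`τ(J_i b₁ X_{i₁} ⋯ b_m X_{i_m} b_{m+1}) = ∑_r δ_{i i_r} τ(b₁ X_{i₁} ⋯ b_r) ·
τ(b_{r+1} X_{i_{r+1}} ⋯ b_{m+1})` for all `m ≥ 0` and `b₁,…,b_{m+1} ∈ B`. -/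
def ConjugateEquations (τ : M →ₗ[ℂ] ℂ) (B : Subalgebra ℂ M) {n : ℕ}
    (X J : Fin n → M) : Prop :=
  ∀ (i : Fin n) (m : ℕ) (b : Fin (m + 1) → M) (idx : Fin m → Fin n),
    (∀ j, b j ∈ B) →
    τ (J i * altWord X b idx) =
      ∑ r : Fin m, (if idx r = i then (1 : ℂ) else 0) *
        τ (altWordBefore X b idx r) * τ (altWordAfter X b idx r)

/-- `J` is the system of conjugate variables of `X₁,…,Xₙ` with respect to `B`. -/
def IsConjugateSystem [StarRing M] (τ : M →ₗ[ℂ] ℂ) (B : Subalgebra ℂ M) {n : ℕ}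
    (X J : Fin n → M) : Prop :=
  (∀ i, MemL2Closure τ ((B : Set M) ∪ Set.range X) (J i)) ∧
    ConjugateEquations τ B X J

/-- the relative free Fisher information `Φ*(X₁,…,Xₙ : B)`; it equals
`∑ᵢ ‖Jᵢ‖₂²` if a conjugate system `J` exists and `∞` otherwise. -/
def phiStar [StarRing M] (τ : M →ₗ[ℂ] ℂ) (B : Subalgebra ℂ M) {n : ℕ}
    (X : Fin n → M) : ℝ≥0∞ :=
  sInf {r : ℝ≥0∞ | ∃ J : Fin n → M, IsConjugateSystem τ B X J ∧
    r = ∑ i, ENNReal.ofReal ((τ (J i * star (J i))).re)}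

namespace IsFaithfulTracialState

variable {τ : M →ₗ[ℂ] ℂ}

lemma map_star (hτ : IsFaithfulTracialState τ) (x : M) :
    τ (star x) = starRingEnd ℂ (τ x) := by
  have h1 := (hτ.pos (1 + x)).2
  have h2 := (hτ.pos (1 + Complex.I • x)).2
  have h3 := (hτ.pos x).2
  simp only [star_add, star_one, star_smul, add_mul, mul_add, one_mul, mul_one, map_add, map_smul,
    smul_mul_assoc, mul_smul_comm, hτ.unital, Complex.add_im, smul_eq_mul, Complex.mul_im,
    Complex.mul_re, Complex.star_def, Complex.conj_I, Complex.neg_re, Complex.neg_im, Complex.I_re,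
    Complex.I_im, Complex.one_im, h3] at h1 h2
  apply Complex.ext
  · rw [Complex.conj_re]; linarith
  · rw [Complex.conj_im]; linarith

/-- The semi-inner product `⟨x, y⟩ = τ(x* y)`. -/
abbrev core (hτ : IsFaithfulTracialState τ) : PreInnerProductSpace.Core ℂ M where
  inner x y := τ (star x * y)
  conj_inner_symm x y := by rw [← hτ.map_star]; simp
  re_inner_nonneg x := (hτ.pos x).1
  add_left x y z := by simp [add_mul]
  smul_left x y r := by simp

lemma norm_map_star_mul_le (hτ : IsFaithfulTracialState τ) (x y : M) :
    ‖τ (star x * y)‖ ≤ √(τ (star x * x)).re * √(τ (star y * y)).re :=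
  letI := hτ.core
  InnerProductSpace.Core.norm_inner_le_norm (𝕜 := ℂ) x y

lemma map_mul_eq_zero_of_approx (hτ : IsFaithfulTracialState τ) {S : Set M} {y z : M}
    (hy : ∀ ε : ℝ, 0 < ε → ∃ a ∈ S, l2Dist τ y a < ε) (hz : ∀ a ∈ S, τ (z * a) = 0) :
    τ (z * y) = 0 := by
  by_contra hne
  have hpos : 0 < ‖τ (z * y)‖ := norm_pos_iff.2 hne
  set c : ℝ := √(τ (z * star z)).re with hc
  have hc0 : 0 ≤ c := Real.sqrt_nonneg _
  obtain ⟨a, ha, hlt⟩ := hy (‖τ (z * y)‖ / (c + 1)) (by positivity)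
  have h1 : τ (z * y) = τ (z * (y - a)) := by rw [mul_sub, map_sub, hz a ha, sub_zero]
  have h2 := hτ.norm_map_star_mul_le (star z) (y - a)
  rw [star_star, ← h1, ← hc, hτ.tracial (star (y - a))] at h2
  change _ ≤ c * l2Dist τ y a at h2
  rw [lt_div_iff₀ (by positivity)] at hlt
  have h3 : 0 ≤ l2Dist τ y a := Real.sqrt_nonneg _
  nlinarith

lemma eq_zero_of_map_mul_star (hτ : IsFaithfulTracialState τ) {x : M}
    (h : τ (x * star x) = 0) : x = 0 :=
  hτ.faithful x (by rw [hτ.tracial, h])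

end IsFaithfulTracialState

/-- `E` is a conditional expectation onto the star-closed subalgebra `D` preserving the
faithful trace `τ`. -/
structure IsTraceExpectation (τ : M →ₗ[ℂ] ℂ) (D : Subalgebra ℂ M) (E : M →ₗ[ℂ] M) : Prop where
  state : IsFaithfulTracialState τ
  star_mem : ∀ d ∈ D, star d ∈ D
  condExp : IsCondExp D E
  map_exp : ∀ x, τ (E x) = τ x

namespace IsTraceExpectation

variable {τ : M →ₗ[ℂ] ℂ} {D : Subalgebra ℂ M} {E : M →ₗ[ℂ] M}

lemma exp_mem (h : IsTraceExpectation τ D E) (x : M) : E x ∈ D := h.condExp.2.1 x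

lemma exp_mul_left (h : IsTraceExpectation τ D E) {d : M} (hd : d ∈ D) (x : M) :
    E (d * x) = d * E x := by
  simpa using h.condExp.2.2 d hd 1 D.one_mem x

lemma exp_mul_right (h : IsTraceExpectation τ D E) {d : M} (hd : d ∈ D) (x : M) :
    E (x * d) = E x * d := by
  simpa using h.condExp.2.2 1 D.one_mem d hd x

lemma exp_of_mem (h : IsTraceExpectation τ D E) {d : M} (hd : d ∈ D) : E d = d := by
  simpa [h.condExp.1] using h.exp_mul_left hd 1

lemma exp_sub_exp (h : IsTraceExpectation τ D E) (x : M) : E (x - E x) = 0 := by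
  rw [map_sub, h.exp_of_mem (h.exp_mem x), sub_self]

lemma map_mul_exp (h : IsTraceExpectation τ D E) (x y : M) : τ (x * E y) = τ (E x * y) := by
  rw [← h.map_exp, h.exp_mul_right (h.exp_mem y), ← h.map_exp (E x * y),
    h.exp_mul_left (h.exp_mem x)]

lemma map_mul_eq_zero (h : IsTraceExpectation τ D E) {d x : M} (hd : d ∈ D) (hx : E x = 0) :
    τ (d * x) = 0 := by
  rw [← h.map_exp, h.exp_mul_left hd, hx, mul_zero, map_zero]

lemma exp_eq_zero (h : IsTraceExpectation τ D E) {x : M} (hx : ∀ d ∈ D, τ (d * x) = 0) :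
    E x = 0 := by
  have hs := h.star_mem _ (h.exp_mem x)
  apply h.state.faithful
  rw [← h.exp_mul_left hs, h.map_exp]
  exact hx _ hs

/-- Dual bases of `D` for the pairing `(x, y) ↦ τ(x y)`. -/
lemma exists_dual_basis (h : IsTraceExpectation τ D E) [FiniteDimensional ℂ D] :
    ∃ (d : ℕ) (e f : Fin d → M), (∀ r, e r ∈ D) ∧ (∀ r, f r ∈ D) ∧
      ∀ x y, ∑ r, τ (x * e r) * τ (f r * y) = τ (E x * y) := by
  let β : LinearMap.BilinForm ℂ D :=
    ((LinearMap.mul ℂ M).compr₂ τ).compl₁₂ D.toSubmodule.subtype D.toSubmodule.subtype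
  have hβ : ∀ x y : D, β x y = τ ((x : M) * y) := fun x y => rfl
  have hnd : β.Nondegenerate := by
    constructor
    · intro x hx
      have := hx ⟨star (x : M), h.star_mem _ x.2⟩
      rw [hβ] at this
      exact Subtype.ext (h.state.eq_zero_of_map_mul_star this)
    · intro x hx
      have := hx ⟨star (x : M), h.star_mem _ x.2⟩
      rw [hβ] at this
      exact Subtype.ext (h.state.faithful _ this)
  let b := Module.finBasis ℂ D
  let b' := β.dualBasis hnd b
  refine ⟨_, fun r => b' r, fun r => b r, fun r => (b' r).2, fun r => (b r).2, fun x y => ?_⟩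
  have h1 : (E y : M) = ∑ r, τ (b r * y) • (b' r : M) := by
    have h2 := b'.sum_repr ⟨E y, h.exp_mem y⟩
    have h3 := congrArg (Subtype.val) h2
    simp only [AddSubmonoidClass.coe_finsetSum, Subalgebra.coe_smul] at h3
    rw [← h3]
    refine Finset.sum_congr rfl fun r _ => ?_
    rw [LinearMap.BilinForm.dualBasis_repr_apply, hβ, h.state.tracial, ← h.exp_mul_left (b r).2,
      h.map_exp]
  rw [← h.map_mul_exp, h1, Finset.mul_sum, map_sum]
  refine Finset.sum_congr rfl fun r _ => ?_
  rw [mul_smul_comm, map_smul, smul_eq_mul, mul_comm]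

end IsTraceExpectation

variable (M) in
/-- Families of bilinear forms on `M`; the pairing `(u, v) ↦ (τ ⊗ τ)(u ∂ᵢ(a) v)` of a tensor
`∂ᵢ(a)` is an example. -/
abbrev Forms (n : ℕ) : Type _ := Fin n → M →ₗ[ℂ] M →ₗ[ℂ] ℂ

variable {n : ℕ}

/-- The forms belonging to `∂(a z) = ∂(a) z + a ∂(z)`. -/
def leibniz (a : M) (T : Forms M n) (z : M) (Z : Forms M n) : Forms M n := fun i =>
  (T i).compl₁₂ LinearMap.id (LinearMap.mulLeft ℂ z) +
    (Z i).compl₁₂ (LinearMap.mulRight ℂ a) LinearMap.id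

@[simp]
lemma leibniz_apply (a : M) (T : Forms M n) (z : M) (Z : Forms M n) (i : Fin n) (u v : M) :
    leibniz a T z Z i u v = T i u (z * v) + Z i (u * a) v := rfl

lemma forms_ext {S T : Forms M n} (h : ∀ i u v, S i u v = T i u v) : S = T :=
  funext fun i => LinearMap.ext₂ (h i)

lemma leibniz_assoc (a : M) (T : Forms M n) (a' : M) (T' : Forms M n) (z : M) (Z : Forms M n) :
    leibniz (a * a') (leibniz a T a' T') z Z = leibniz a T (a' * z) (leibniz a' T' z Z) :=
  forms_ext fun i u v => by simp [mul_assoc, add_assoc]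

lemma leibniz_zero (a z : M) : leibniz a (0 : Forms M n) z 0 = 0 :=
  forms_ext fun i u v => by simp

lemma leibniz_one_zero (z : M) (Z : Forms M n) : leibniz 1 0 z Z = Z :=
  forms_ext fun i u v => by simp

/-- The forms belonging to `∂ᵢ(X k) = δ_{ik} 1 ⊗ 1`. -/
def varForm (τ : M →ₗ[ℂ] ℂ) (k : Fin n) : Forms M n := fun i =>
  if k = i then τ.smulRight τ else 0

lemma varForm_apply (τ : M →ₗ[ℂ] ℂ) (k i : Fin n) (u v : M) :
    varForm τ k i u v = if k = i then τ u * τ v else 0 := by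
  unfold varForm; split_ifs <;> simp

/-- Words in `B` and the `X k`, paired with the forms of their free difference quotients. -/
inductive IsWord (τ : M →ₗ[ℂ] ℂ) (B : Subalgebra ℂ M) (X : Fin n → M) : M → Forms M n → Prop
  | base {b : M} (hb : b ∈ B) : IsWord τ B X b 0
  | cons {b : M} (hb : b ∈ B) (k : Fin n) {z : M} {Z : Forms M n} (hz : IsWord τ B X z Z) :
      IsWord τ B X (b * X k * z)
        (leibniz (b * X k) (leibniz b 0 (X k) (varForm τ k)) z Z)

section altWord

variable (X : Fin n → M) {m : ℕ} (b₀ : M) (b : Fin (m + 1) → M) (k : Fin n) (idx : Fin m → Fin n)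

lemma altWord_cons : altWord X (Fin.cons b₀ b : Fin (m + 2) → M) (Fin.cons k idx) =
    b₀ * X k * altWord X b idx := by
  simp [altWord, List.ofFn_succ, mul_assoc, ← Fin.succ_last]

lemma altWordBefore_cons_zero :
    altWordBefore X (Fin.cons b₀ b : Fin (m + 2) → M) (Fin.cons k idx) 0 = b₀ := by
  simp [altWordBefore]

lemma altWordAfter_cons_zero :
    altWordAfter X (Fin.cons b₀ b : Fin (m + 2) → M) (Fin.cons k idx) 0 = altWord X b idx := by
  simp [altWordAfter, altWord, List.finRange_succ, List.filter_map, Function.comp_def,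
    List.ofFn_eq_map, ← Fin.succ_last]

lemma altWordBefore_cons_succ (r : Fin m) :
    altWordBefore X (Fin.cons b₀ b : Fin (m + 2) → M) (Fin.cons k idx) r.succ =
      b₀ * X k * altWordBefore X b idx r := by
  simp [altWordBefore, List.finRange_succ, List.filter_map, Function.comp_def, mul_assoc]

lemma altWordAfter_cons_succ (r : Fin m) :
    altWordAfter X (Fin.cons b₀ b : Fin (m + 2) → M) (Fin.cons k idx) r.succ =
      altWordAfter X b idx r := by
  simp [altWordAfter, List.finRange_succ, List.filter_map, Function.comp_def, ← Fin.succ_last]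

end altWord

lemma IsWord.exists_altWord {τ : M →ₗ[ℂ] ℂ} {B : Subalgebra ℂ M} {X : Fin n → M} {z : M}
    {Z : Forms M n} (h : IsWord τ B X z Z) :
    ∃ (m : ℕ) (b : Fin (m + 1) → M) (idx : Fin m → Fin n), (∀ j, b j ∈ B) ∧
      z = altWord X b idx ∧ ∀ i u v, Z i u v = ∑ r : Fin m, (if idx r = i then (1 : ℂ) else 0) *
        τ (u * altWordBefore X b idx r) * τ (altWordAfter X b idx r * v) := by
  induction h with
  | @base b hb => exact ⟨0, fun _ => b, Fin.elim0, fun _ => hb, by simp [altWord], by simp⟩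
  | @cons b₀ hb₀ k z Z hz ih =>
    obtain ⟨m, b, idx, hb, rfl, hZ⟩ := ih
    refine ⟨m + 1, Fin.cons b₀ b, Fin.cons k idx, ?_, (altWord_cons ..).symm, fun i u v => ?_⟩
    · exact Fin.cases hb₀ hb
    · rw [Fin.sum_univ_succ]
      simp only [altWordBefore_cons_zero, altWordAfter_cons_zero, altWordBefore_cons_succ,
        altWordAfter_cons_succ, Fin.cons_zero, Fin.cons_succ, leibniz_apply, varForm_apply, hZ]
      simp [mul_assoc]

/-- The span of the words paired with the forms of their free difference quotients. -/
def wordSpan (τ : M →ₗ[ℂ] ℂ) (B : Subalgebra ℂ M) (X : Fin n → M) : Submodule ℂ (M × Forms M n) :=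
  Submodule.span ℂ {p | IsWord τ B X p.1 p.2}

lemma ConjugateEquations.map_mul_of_mem_wordSpan {τ : M →ₗ[ℂ] ℂ} {B : Subalgebra ℂ M}
    {X J : Fin n → M} (h : ConjugateEquations τ B X J) {p : M × Forms M n}
    (hp : p ∈ wordSpan τ B X) (i : Fin n) : τ (J i * p.1) = p.2 i 1 1 := by
  induction hp using Submodule.span_induction with
  | mem p hp =>
    obtain ⟨m, b, idx, hb, hz, hZ⟩ := IsWord.exists_altWord hp
    rw [hz, h i m b idx hb, hZ]
    simp
  | zero => simp
  | add p q _ _ hp hq => simp [mul_add, hp, hq]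
  | smul c p _ hp => simp [hp]

/-- `T` consists of the forms of the free difference quotients of `a`. -/
def IsDerivPair (τ : M →ₗ[ℂ] ℂ) (B : Subalgebra ℂ M) (X : Fin n → M) (a : M) (T : Forms M n) :
    Prop :=
  ∀ p ∈ wordSpan τ B X, (a * p.1, leibniz a T p.1 p.2) ∈ wordSpan τ B X

namespace IsDerivPair

variable {τ : M →ₗ[ℂ] ℂ} {B : Subalgebra ℂ M} {X : Fin n → M} {a a' : M} {T T' : Forms M n}

lemma of_isWord (h : ∀ z Z, IsWord τ B X z Z → (a * z, leibniz a T z Z) ∈ wordSpan τ B X) :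
    IsDerivPair τ B X a T := by
  intro p hp
  induction hp using Submodule.span_induction with
  | mem p hp => exact h _ _ hp
  | zero =>
    convert (wordSpan τ B X).zero_mem using 1
    exact Prod.ext (by simp) (forms_ext fun i u v => by simp)
  | add p q _ _ hp hq =>
    convert (wordSpan τ B X).add_mem hp hq using 1
    exact Prod.ext (by simp [mul_add]) (forms_ext fun i u v => by simp [add_mul]; ring)
  | smul c p _ hp =>
    convert (wordSpan τ B X).smul_mem c hp using 1
    exact Prod.ext (by simp) (forms_ext fun i u v => by simp [mul_add])

lemma of_mem (ha : a ∈ B) : IsDerivPair τ B X a 0 := by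
  refine of_isWord fun z Z hz => Submodule.subset_span ?_
  cases hz with
  | @base b hb => rw [leibniz_zero]; exact IsWord.base (B.mul_mem ha hb)
  | @cons b hb k z Z hz =>
    have := IsWord.cons (B.mul_mem ha hb) k hz
    rwa [← leibniz_zero a b, mul_assoc a b, mul_assoc a (b * X k), leibniz_assoc,
      leibniz_assoc] at this

lemma of_generator (k : Fin n) : IsDerivPair τ B X (X k) (varForm τ k) := by
  refine of_isWord fun z Z hz => Submodule.subset_span ?_
  have := IsWord.cons B.one_mem k hz
  rwa [leibniz_one_zero, one_mul] at this

lemma add (h : IsDerivPair τ B X a T) (h' : IsDerivPair τ B X a' T') :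
    IsDerivPair τ B X (a + a') (T + T') := by
  intro p hp
  convert (wordSpan τ B X).add_mem (h p hp) (h' p hp) using 1
  exact Prod.ext (by simp [add_mul]) (forms_ext fun i u v => by simp [mul_add]; ring)

lemma mul (h : IsDerivPair τ B X a T) (h' : IsDerivPair τ B X a' T') :
    IsDerivPair τ B X (a * a') (leibniz a T a' T') := by
  intro p hp
  rw [leibniz_assoc, mul_assoc]
  exact h _ (h' p hp)

lemma map_mul {J : Fin n → M} (h : IsDerivPair τ B X a T) (hJ : ConjugateEquations τ B X J)
    (i : Fin n) : τ (J i * a) = T i 1 1 := by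
  have := hJ.map_mul_of_mem_wordSpan (h (1, 0) (Submodule.subset_span (.base B.one_mem))) i
  simpa using this

end IsDerivPair

lemma sup_adjoin_range (C : Subalgebra ℂ M) (X : Fin n → M) :
    C ⊔ Algebra.adjoin ℂ (Set.range X) = Algebra.adjoin ℂ ((C : Set M) ∪ Set.range X) := by
  rw [Algebra.adjoin_union, Algebra.adjoin_eq]

lemma exists_isDerivPair {τ : M →ₗ[ℂ] ℂ} {B C : Subalgebra ℂ M} {X : Fin n → M} (hCB : C ≤ B)
    (P : M → Forms M n → Prop) (hbase : ∀ c ∈ C, P c 0) (hvar : ∀ k, P (X k) (varForm τ k))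
    (hadd : ∀ a T a' T', P a T → P a' T' → P (a + a') (T + T'))
    (hmul : ∀ a T a' T', P a T → P a' T' → P (a * a') (leibniz a T a' T')) {a : M}
    (ha : a ∈ C ⊔ Algebra.adjoin ℂ (Set.range X)) : ∃ T, IsDerivPair τ B X a T ∧ P a T := by
  rw [sup_adjoin_range] at ha
  induction ha using Algebra.adjoin_induction with
  | mem x hx =>
    rcases hx with hx | ⟨k, rfl⟩
    · exact ⟨0, .of_mem (hCB hx), hbase x hx⟩
    · exact ⟨_, .of_generator k, hvar k⟩
  | algebraMap r =>
    exact ⟨0, .of_mem (B.algebraMap_mem r), hbase _ (C.algebraMap_mem r)⟩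
  | add x y _ _ hx hy =>
    obtain ⟨T, hT, hPT⟩ := hx
    obtain ⟨S, hS, hPS⟩ := hy
    exact ⟨_, hT.add hS, hadd _ _ _ _ hPT hPS⟩
  | mul x y _ _ hx hy =>
    obtain ⟨T, hT, hPT⟩ := hx
    obtain ⟨S, hS, hPS⟩ := hy
    exact ⟨_, hT.mul hS, hmul _ _ _ _ hPT hPS⟩

/-- `y` lies in the `‖·‖₂`-closure of the subalgebra `N`. -/
def IsL2Limit (τ : M →ₗ[ℂ] ℂ) (N : Subalgebra ℂ M) (y : M) : Prop :=
  ∀ ε : ℝ, 0 < ε → ∃ a ∈ N, l2Dist τ y a < ε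

lemma IsL2Limit.star {τ : M →ₗ[ℂ] ℂ} (hτ : IsFaithfulTracialState τ) {N : Subalgebra ℂ M}
    (hN : ∀ a ∈ N, star a ∈ N) {y : M} (hy : IsL2Limit τ N y) : IsL2Limit τ N (star y) := by
  intro ε hε
  obtain ⟨a, ha, hlt⟩ := hy ε hε
  refine ⟨_, hN a ha, ?_⟩
  rwa [l2Dist, ← star_sub, star_star, hτ.tracial]

section generated

variable {C : Subalgebra ℂ M} {X : Fin n → M}

lemma star_mem_sup_adjoin (hC : ∀ c ∈ C, star c ∈ C) (hX : ∀ i, IsSelfAdjoint (X i)) :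
    ∀ a ∈ C ⊔ Algebra.adjoin ℂ (Set.range X), star a ∈ C ⊔ Algebra.adjoin ℂ (Set.range X) := by
  intro a ha
  rw [sup_adjoin_range] at ha ⊢
  induction ha using Algebra.adjoin_induction with
  | mem x hx =>
    apply Algebra.subset_adjoin
    rcases hx with hx | ⟨k, rfl⟩
    · exact Or.inl (hC x hx)
    · exact Or.inr ⟨k, (hX k).symm⟩
  | algebraMap r => rw [← algebraMap_star_comm]; exact Subalgebra.algebraMap_mem _ _
  | add x y _ _ hx hy => rw [star_add]; exact add_mem hx hy
  | mul x y _ _ hx hy => rw [star_mul]; exact mul_mem hy hx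

lemma memL2Closure_iff {τ : M →ₗ[ℂ] ℂ} (hC : ∀ c ∈ C, star c ∈ C)
    (hX : ∀ i, IsSelfAdjoint (X i)) (y : M) :
    MemL2Closure τ ((C : Set M) ∪ Set.range X) y ↔
      IsL2Limit τ (C ⊔ Algebra.adjoin ℂ (Set.range X)) y := by
  have : ((C : Set M) ∪ Set.range X) ∪ star '' ((C : Set M) ∪ Set.range X) =
      (C : Set M) ∪ Set.range X := by
    refine Set.union_eq_left.2 ?_
    rintro _ ⟨x, hx | ⟨k, rfl⟩, rfl⟩
    · exact Or.inl (hC x hx)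
    · exact Or.inr ⟨k, (hX k).symm⟩
  rw [MemL2Closure, this, IsL2Limit, sup_adjoin_range]

end generated

lemma ConjugateEquations.mono {τ : M →ₗ[ℂ] ℂ} {B D : Subalgebra ℂ M} (hDB : D ≤ B)
    {X J : Fin n → M} (h : ConjugateEquations τ B X J) : ConjugateEquations τ D X J :=
  fun i m b idx hb => h i m b idx fun j => hDB (hb j)

lemma ConjugateEquations.map_mul_eq {τ : M →ₗ[ℂ] ℂ} {B : Subalgebra ℂ M} {X J J' : Fin n → M}
    (h : ConjugateEquations τ B X J) (h' : ConjugateEquations τ B X J') (i : Fin n) {a : M}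
    (ha : a ∈ B ⊔ Algebra.adjoin ℂ (Set.range X)) : τ (J i * a) = τ (J' i * a) := by
  obtain ⟨T, hT, -⟩ := exists_isDerivPair (τ := τ) le_rfl (fun _ _ => True)
    (by simp) (by simp) (by simp) (by simp) ha
  rw [hT.map_mul h, hT.map_mul h']

lemma map_mul_star_eq_add {τ : M →ₗ[ℂ] ℂ} (hτ : IsFaithfulTracialState τ) {N : Subalgebra ℂ M}
    (hN : ∀ a ∈ N, star a ∈ N) {x y : M} (hy : IsL2Limit τ N y)
    (hxy : ∀ a ∈ N, τ (x * a) = τ (y * a)) :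
    τ (x * star x) = τ (y * star y) + τ ((x - y) * star (x - y)) := by
  have h1 : τ ((x - y) * star y) = 0 :=
    hτ.map_mul_eq_zero_of_approx (hy.star hτ hN) fun a ha => by
      rw [sub_mul, map_sub, hxy a ha, sub_self]
  have h2 : τ (y * star (x - y)) = 0 := by
    have := hτ.map_star ((x - y) * star y)
    rwa [h1, map_zero, star_mul, star_star] at this
  have h3 : x * star x = (x - y) * star (x - y) + y * star (x - y) + (x - y) * star y
      + y * star y := by
    rw [star_sub]; noncomm_ring
  rw [h3, map_add, map_add, map_add, h1, h2]
  ring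

section phiStar

variable {τ : M →ₗ[ℂ] ℂ} {B : Subalgebra ℂ M} {X J J' : Fin n → M}

lemma IsConjugateSystem.unique (hτ : IsFaithfulTracialState τ) (hB : ∀ b ∈ B, star b ∈ B)
    (hX : ∀ i, IsSelfAdjoint (X i)) (h : IsConjugateSystem τ B X J)
    (h' : IsConjugateSystem τ B X J') : J = J' := by
  funext i
  have hN := star_mem_sup_adjoin hB hX
  have hJ := (memL2Closure_iff hB hX _).1 (h.1 i)
  have hJ' := (memL2Closure_iff hB hX _).1 (h'.1 i)
  have e1 := map_mul_star_eq_add hτ hN hJ' fun a ha => h.2.map_mul_eq h'.2 i ha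
  have e2 := map_mul_star_eq_add hτ hN hJ fun a ha => h'.2.map_mul_eq h.2 i ha
  have e3 : (J' i - J i) * star (J' i - J i) = (J i - J' i) * star (J i - J' i) := by
    rw [← neg_sub (J i), star_neg, neg_mul_neg]
  rw [e3] at e2
  refine sub_eq_zero.1 (hτ.eq_zero_of_map_mul_star ?_)
  linear_combination (e2 + e1) / -2

lemma IsConjugateSystem.phiStar_eq (hτ : IsFaithfulTracialState τ) (hB : ∀ b ∈ B, star b ∈ B)
    (hX : ∀ i, IsSelfAdjoint (X i)) (h : IsConjugateSystem τ B X J) :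
    phiStar τ B X = ∑ i, ENNReal.ofReal ((τ (J i * star (J i))).re) := by
  apply le_antisymm
  · exact sInf_le ⟨J, h, rfl⟩
  · refine le_sInf ?_
    rintro _ ⟨J', h', rfl⟩
    rw [h.unique hτ hB hX h']

lemma exists_isConjugateSystem (h : phiStar τ B X ≠ ⊤) : ∃ J, IsConjugateSystem τ B X J := by
  by_contra! hne
  refine h (sInf_eq_top.2 ?_)
  rintro _ ⟨J, hJ, -⟩
  exact absurd hJ (hne J)

/-- Equality of the relative free Fisher informations forces the conjugate variables with respect
to `B` to be approximated by the algebra generated by `D` and the `X i`. -/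
lemma isL2Limit_of_phiStar_eq {D : Subalgebra ℂ M} (hτ : IsFaithfulTracialState τ)
    (hB : ∀ b ∈ B, star b ∈ B) (hD : ∀ d ∈ D, star d ∈ D) (hDB : D ≤ B)
    (hX : ∀ i, IsSelfAdjoint (X i)) (h : IsConjugateSystem τ B X J)
    (heq : phiStar τ D X = phiStar τ B X) (i : Fin n) :
    IsL2Limit τ (D ⊔ Algebra.adjoin ℂ (Set.range X)) (J i) := by
  have hfin : phiStar τ D X ≠ ⊤ := by
    rw [heq, h.phiStar_eq hτ hB hX]; exact ENNReal.sum_ne_top.2 fun _ _ => ENNReal.ofReal_ne_top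
  obtain ⟨J', h'⟩ := exists_isConjugateSystem hfin
  have hN := star_mem_sup_adjoin hD hX
  have hJ' := fun i => (memL2Closure_iff hD hX _).1 (h'.1 i)
  have hadd := fun i => map_mul_star_eq_add hτ hN (hJ' i) fun a ha =>
    (h.2.mono hDB).map_mul_eq h'.2 i ha
  have hpos : ∀ x : M, 0 ≤ (τ (x * star x)).re := fun x => by
    rw [hτ.tracial]; exact (hτ.pos x).1
  rw [h.phiStar_eq hτ hB hX, h'.phiStar_eq hτ hD hX,
    ← ENNReal.ofReal_sum_of_nonneg fun _ _ => hpos _,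
    ← ENNReal.ofReal_sum_of_nonneg fun _ _ => hpos _,
    ENNReal.ofReal_eq_ofReal_iff (Finset.sum_nonneg fun _ _ => hpos _)
      (Finset.sum_nonneg fun _ _ => hpos _)] at heq
  simp only [hadd, Complex.add_re, Finset.sum_add_distrib, left_eq_add] at heq
  rw [Finset.sum_eq_zero_iff_of_nonneg fun _ _ => hpos _] at heq
  have hi : J i - J' i = 0 := by
    apply hτ.eq_zero_of_map_mul_star
    apply Complex.ext (heq i (Finset.mem_univ i))
    rw [hτ.tracial]; exact (hτ.pos _).2
  rw [sub_eq_zero.1 hi]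
  exact hJ' i

end phiStar

section freeness

variable {τ : M →ₗ[ℂ] ℂ} {B D N : Subalgebra ℂ M} {E : M →ₗ[ℂ] M}

/-- `IsReduced E N B m y`: `y` is an alternating product of `E`-centered elements, starting and
ending in `B`, with `m` factors in `N`. -/
inductive IsReduced (E : M →ₗ[ℂ] M) (N B : Subalgebra ℂ M) : ℕ → M → Prop
  | single {b : M} (hb : b ∈ B) (hEb : E b = 0) : IsReduced E N B 0 b
  | cons {b c w : M} {m : ℕ} (hb : b ∈ B) (hEb : E b = 0) (hc : c ∈ N) (hEc : E c = 0)
      (hw : IsReduced E N B m w) : IsReduced E N B (m + 1) (b * (c * w))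

/-- The hypotheses on an alternating product of centered elements of `S₁` and `S₂`. -/
def IsAlternating (E : M →ₗ[ℂ] M) (S₁ S₂ : Set M) (k : ℕ) (a : Fin k → M) (f : Fin k → Bool) :
    Prop :=
  (∀ j, a j ∈ (if f j then S₁ else S₂)) ∧ (∀ j, E (a j) = 0) ∧
    ∀ (j : ℕ) (h : j + 1 < k), f ⟨j, Nat.lt_of_succ_lt h⟩ ≠ f ⟨j + 1, h⟩

lemma IsAlternating.cons {S₁ S₂ : Set M} {k : ℕ} {a : Fin (k + 1) → M} {f : Fin (k + 1) → Bool}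
    (h : IsAlternating E S₁ S₂ (k + 1) a f) {x : M} {g : Bool} (hx : x ∈ (if g then S₁ else S₂))
    (hEx : E x = 0) (hg : g ≠ f 0) :
    IsAlternating E S₁ S₂ (k + 2) (Fin.cons x a : Fin (k + 2) → M)
      (Fin.cons g f : Fin (k + 2) → Bool) := by
  refine ⟨Fin.cases (by simpa using hx) (by simpa using h.1),
    Fin.cases (by simpa using hEx) (by simpa using h.2.1), fun j hj => ?_⟩
  cases j with
  | zero => exact hg
  | succ j => exact h.2.2 j (Nat.lt_of_succ_lt_succ hj)

lemma IsAlternating.tail {S₁ S₂ : Set M} {k : ℕ} {a : Fin (k + 1) → M} {f : Fin (k + 1) → Bool}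
    (h : IsAlternating E S₁ S₂ (k + 1) a f) :
    IsAlternating E S₁ S₂ k (fun j => a j.succ) (fun j => f j.succ) :=
  ⟨fun j => h.1 j.succ, fun j => h.2.1 j.succ, fun j hj => h.2.2 (j + 1) (Nat.succ_lt_succ hj)⟩

lemma IsReduced.exists_isAlternating {m : ℕ} {y : M} (h : IsReduced E N B m y) :
    ∃ (k : ℕ) (a : Fin (k + 1) → M) (f : Fin (k + 1) → Bool),
      IsAlternating E (N : Set M) (B : Set M) (k + 1) a f ∧ f 0 = false ∧
        (List.ofFn a).prod = y := by
  induction h with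
  | @single b hb hEb =>
    exact ⟨0, fun _ => b, fun _ => false, ⟨by simpa using hb, fun _ => hEb, by simp⟩, rfl, by simp⟩
  | @cons b c w m hb hEb hc hEc hw ih =>
    obtain ⟨k, a, f, h, hf, hw⟩ := ih
    have h1 := h.cons (x := c) (g := true) (by simpa using hc) hEc (by simp [hf])
    have h2 := h1.cons (x := b) (g := false) (by simpa using hb) hEb (by simp)
    exact ⟨_, _, _, h2, rfl, by simp [List.ofFn_succ, ← hw]⟩

lemma IsAlternating.exists_isReduced : ∀ {k : ℕ} {a : Fin (k + 1) → M} {f : Fin (k + 1) → Bool},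
    IsAlternating E (N : Set M) (B : Set M) (k + 1) a f →
    (f 0 = false → ∃ m y c, IsReduced E N B m y ∧ c ∈ N ∧ (List.ofFn a).prod = y * c) ∧
    (f 0 = true → ((List.ofFn a).prod ∈ N ∧ E (List.ofFn a).prod = 0) ∨
      ∃ c₀ m y c, c₀ ∈ N ∧ E c₀ = 0 ∧ IsReduced E N B m y ∧ c ∈ N ∧
        (List.ofFn a).prod = c₀ * (y * c)) := by
  intro k
  induction k with
  | zero =>
    intro a f h
    have h0 := h.1 0
    have hE := h.2.1 0
    refine ⟨fun hf => ⟨0, a 0, 1, .single (by simpa [hf] using h0) hE, N.one_mem, by simp⟩,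
      fun hf => Or.inl ?_⟩
    simpa [hf, hE] using h0
  | succ k ih =>
    intro a f h
    obtain ⟨ih1, ih2⟩ := ih h.tail
    have h0 := h.1 0
    have hE := h.2.1 0
    have hne : f 0 ≠ f (Fin.succ 0) := h.2.2 0 (by omega)
    refine ⟨fun hf => ?_, fun hf => ?_⟩
    · have hb : a 0 ∈ B := by simpa [hf] using h0
      rcases ih2 (by simpa [hf] using hne.symm) with ⟨hc, hEc⟩ | ⟨c₀, m, y, c, hc₀, hEc₀, hy, hc, hp⟩
      · exact ⟨0, a 0, _, .single hb hE, hc, by rw [List.ofFn_succ, List.prod_cons]⟩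
      · exact ⟨m + 1, _, c, .cons hb hE hc₀ hEc₀ hy, hc, by
          rw [List.ofFn_succ, List.prod_cons, hp]; simp only [mul_assoc]⟩
    · have hb : a 0 ∈ N := by simpa [hf] using h0
      obtain ⟨m, y, c, hy, hc, hp⟩ := ih1 (by simpa [hf] using hne.symm)
      exact Or.inr ⟨a 0, m, y, c, hb, hE, hy, hc, by rw [List.ofFn_succ, List.prod_cons, hp]⟩

/-- Freeness with amalgamation over `D` amounts to the vanishing of the trace on products of an
element of `N` and a reduced word. -/
lemma isFreeWithAmalgamation_iff_s17 (h : IsTraceExpectation τ D E) (hDN : D ≤ N) :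
    IsFreeWithAmalgamation E (N : Set M) (B : Set M) ↔
      ∀ m y, IsReduced E N B m y → ∀ c ∈ N, τ (c * y) = 0 := by
  constructor
  · intro hfree m y hy c hc
    obtain ⟨k, a, f, hk, hf, rfl⟩ := hy.exists_isAlternating
    have h1 := hfree _ (Nat.succ_pos k) a f hk.1 hk.2.1 hk.2.2
    have h2 := hk.cons (x := c - E c) (g := true)
      (by simpa using N.sub_mem hc (hDN (h.exp_mem c))) (h.exp_sub_exp c) (by simp [hf])
    have h3 := hfree _ (Nat.succ_pos _) _ _ h2.1 h2.2.1 h2.2.2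
    rw [List.ofFn_succ, List.prod_cons] at h3
    simp only [Fin.cons_zero, Fin.cons_succ] at h3
    have h4 := h.map_exp ((c - E c) * (List.ofFn a).prod)
    rw [h3, map_zero, sub_mul, map_sub, h.map_mul_eq_zero (h.exp_mem c) h1, sub_zero] at h4
    exact h4.symm
  · intro hQ k hk a f h1 h2 h3
    obtain ⟨k, rfl⟩ := Nat.exists_eq_succ_of_ne_zero hk.ne'
    obtain ⟨hB, hN⟩ := IsAlternating.exists_isReduced (E := E) ⟨h1, h2, h3⟩
    cases hf : f 0 with
    | false =>
      obtain ⟨m, y, c, hy, hc, hp⟩ := hB hf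
      rw [hp]
      refine h.exp_eq_zero fun d hd => ?_
      rw [← mul_assoc, h.state.tracial, ← mul_assoc]
      exact hQ m y hy _ (N.mul_mem hc (hDN hd))
    | true =>
      rcases hN hf with ⟨-, h0⟩ | ⟨c₀, m, y, c, hc₀, -, hy, hc, hp⟩
      · exact h0
      rw [hp]
      refine h.exp_eq_zero fun d hd => ?_
      rw [← mul_assoc, ← mul_assoc, h.state.tracial, ← mul_assoc]
      exact hQ m y hy _ (N.mul_mem hc (N.mul_mem (hDN hd) hc₀))

end freeness

section free_imp_eq

variable {τ : M →ₗ[ℂ] ℂ} {B D N : Subalgebra ℂ M} {E : M →ₗ[ℂ] M} {X J : Fin n → M}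

/-- `u` is orthogonal to `N` for the pairing `(x, y) ↦ τ(x y)`. -/
def IsPerp (τ : M →ₗ[ℂ] ℂ) (N : Subalgebra ℂ M) (u : M) : Prop := ∀ a ∈ N, τ (u * a) = 0

lemma IsPerp.map_eq_zero {u : M} (hu : IsPerp τ N u) : τ u = 0 := by
  simpa using hu 1 N.one_mem

lemma IsPerp.mul_right {u c : M} (hu : IsPerp τ N u) (hc : c ∈ N) : IsPerp τ N (u * c) :=
  fun a ha => by rw [mul_assoc]; exact hu _ (N.mul_mem hc ha)

lemma IsPerp.mul_left (hτ : IsFaithfulTracialState τ) {u c : M} (hu : IsPerp τ N u)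
    (hc : c ∈ N) : IsPerp τ N (c * u) :=
  fun a ha => by rw [mul_assoc, hτ.tracial, mul_assoc]; exact hu _ (N.mul_mem ha hc)

lemma IsReduced.isPerp (hτ : IsFaithfulTracialState τ)
    (hQ : ∀ m y, IsReduced E N B m y → ∀ c ∈ N, τ (c * y) = 0) {m : ℕ} {y : M}
    (hy : IsReduced E N B m y) : IsPerp τ N y :=
  fun a ha => by rw [hτ.tracial]; exact hQ m y hy a ha

/-- The forms of the free difference quotients of elements of the algebra generated by `D` and the
`X i` vanish against its orthogonal complement. -/
lemma exists_isDerivPair_vanishing (hτ : IsFaithfulTracialState τ) (hDB : D ≤ B)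
    (hN : N = D ⊔ Algebra.adjoin ℂ (Set.range X)) {a : M} (ha : a ∈ N) :
    ∃ T, IsDerivPair τ B X a T ∧ ∀ i u v, IsPerp τ N u ∨ IsPerp τ N v → T i u v = 0 := by
  have hDN : D ≤ N := hN ▸ le_sup_left
  have hXN : ∀ k, X k ∈ N := fun k =>
    hN ▸ le_sup_right (a := D) (Algebra.subset_adjoin ⟨k, rfl⟩)
  rw [hN] at ha
  suffices ∃ T, IsDerivPair τ B X a T ∧ a ∈ N ∧
      ∀ i u v, IsPerp τ N u ∨ IsPerp τ N v → T i u v = 0 by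
    obtain ⟨T, hT, -, hT'⟩ := this
    exact ⟨T, hT, hT'⟩
  refine exists_isDerivPair hDB (fun a T => a ∈ N ∧ ∀ i u v,
    IsPerp τ N u ∨ IsPerp τ N v → T i u v = 0) (fun c hc => ⟨hDN hc, fun _ _ _ _ => rfl⟩)
    (fun k => ⟨hXN k, fun i u v huv => ?_⟩)
    (fun a T a' T' h h' => ⟨add_mem h.1 h'.1, fun i u v huv => ?_⟩)
    (fun a T a' T' h h' => ⟨mul_mem h.1 h'.1, fun i u v huv => ?_⟩) ha
  · rw [varForm_apply]
    rcases huv with hu | hv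
    · simp [hu.map_eq_zero]
    · simp [hv.map_eq_zero]
  · simp [h.2 i u v huv, h'.2 i u v huv]
  · rw [leibniz_apply, h.2 i u _ (huv.imp_right fun hv => hv.mul_left hτ h'.1),
      h'.2 i _ v (huv.imp_left fun hu => hu.mul_right h.1), add_zero]

lemma IsReduced.exists_isDerivPair_vanishing (hτ : IsFaithfulTracialState τ) (hDB : D ≤ B)
    (hN : N = D ⊔ Algebra.adjoin ℂ (Set.range X))
    (hQ : ∀ m y, IsReduced E N B m y → ∀ c ∈ N, τ (c * y) = 0) {m : ℕ} {y : M}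
    (hy : IsReduced E N B m y) :
    ∃ T, IsDerivPair τ B X y T ∧ ∀ i u, ∀ v ∈ N, T i u v = 0 := by
  induction hy with
  | single hb => exact ⟨0, .of_mem hb, fun _ _ _ _ => rfl⟩
  | cons hb hEb hc hEc hw ih =>
    obtain ⟨S, hS, hS'⟩ := ih
    obtain ⟨T, hT, hT'⟩ := OVD.exists_isDerivPair_vanishing hτ hDB hN hc
    refine ⟨_, (IsDerivPair.of_mem hb).mul (hT.mul hS), fun i u v hv => ?_⟩
    rw [leibniz_apply, leibniz_apply, hS' i _ v hv,
      hT' i _ _ (Or.inr ((hw.isPerp hτ hQ).mul_right hv)), Pi.zero_apply, LinearMap.zero_apply,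
      LinearMap.zero_apply, add_zero, add_zero]

/-- The span of the products `c y c'` with `c, c' ∈ N` and `y` a reduced word. -/
def reducedSpan (E : M →ₗ[ℂ] M) (N B : Subalgebra ℂ M) : Submodule ℂ M :=
  Submodule.span ℂ {p | ∃ m y c c', IsReduced E N B m y ∧ c ∈ N ∧ c' ∈ N ∧ p = c * (y * c')}

lemma mem_reducedSpan {m : ℕ} {y c c' : M} (hy : IsReduced E N B m y) (hc : c ∈ N)
    (hc' : c' ∈ N) : c * (y * c') ∈ reducedSpan E N B :=
  Submodule.subset_span ⟨m, y, c, c', hy, hc, hc', rfl⟩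

lemma mem_reducedSpan_right {m : ℕ} {y c' : M} (hy : IsReduced E N B m y) (hc' : c' ∈ N) :
    y * c' ∈ reducedSpan E N B := by
  simpa using mem_reducedSpan hy N.one_mem hc'

lemma mul_mem_sup_reducedSpan_of_right (h : IsTraceExpectation τ D E) (hDB : D ≤ B) (hDN : D ≤ N)
    {b c' y : M} {m : ℕ} (hb : b ∈ B) (hy : IsReduced E N B m y) (hc' : c' ∈ N) :
    b * (y * c') ∈ Subalgebra.toSubmodule N ⊔ reducedSpan E N B := by
  cases hy with
  | single hb₁ =>
    have h1 : b * (y * c') = E (b * y) * c' + (b * y - E (b * y)) * c' := by noncomm_ring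
    rw [h1]
    exact Submodule.add_mem_sup (N.mul_mem (hDN (h.exp_mem _)) hc')
      (mem_reducedSpan_right (.single (B.sub_mem (B.mul_mem hb hb₁) (hDB (h.exp_mem _)))
        (h.exp_sub_exp _)) hc')
  | @cons b₁ c₁ w m hb₁ hEb₁ hc₁ hEc₁ hw =>
    have h1 : b * (b₁ * (c₁ * w) * c') = E (b * b₁) * c₁ * (w * c')
        + (b * b₁ - E (b * b₁)) * (c₁ * w) * c' := by noncomm_ring
    rw [h1]
    exact Submodule.mem_sup_right (add_mem
      (mem_reducedSpan hw (N.mul_mem (hDN (h.exp_mem _)) hc₁) hc')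
      (mem_reducedSpan_right (.cons (B.sub_mem (B.mul_mem hb hb₁) (hDB (h.exp_mem _)))
        (h.exp_sub_exp _) hc₁ hEc₁ hw) hc'))

lemma mul_mem_sup_reducedSpan (h : IsTraceExpectation τ D E) (hDB : D ≤ B) (hDN : D ≤ N)
    {b z : M} (hb : b ∈ B) (hz : z ∈ Subalgebra.toSubmodule N ⊔ reducedSpan E N B) :
    b * z ∈ Subalgebra.toSubmodule N ⊔ reducedSpan E N B := by
  have hEb := h.exp_mem b
  have hb' : IsReduced E N B 0 (b - E b) := .single (B.sub_mem hb (hDB hEb)) (h.exp_sub_exp _)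
  obtain ⟨a, ha, w, hw, rfl⟩ := Submodule.mem_sup.1 hz
  rw [mul_add]
  refine add_mem ?_ ?_
  · have h1 : b * a = E b * a + (b - E b) * a := by noncomm_ring
    rw [h1]
    exact Submodule.add_mem_sup (N.mul_mem (hDN hEb) ha) (mem_reducedSpan_right hb' ha)
  · clear hz
    induction hw using Submodule.span_induction with
    | mem p hp =>
      obtain ⟨m, y, c, c', hy, hc, hc', rfl⟩ := hp
      have hc₀ : c - E c ∈ N := N.sub_mem hc (hDN (h.exp_mem c))
      have h1 : b * (c * (y * c')) = b * E c * (y * c') + E b * (c - E c) * (y * c')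
          + (b - E b) * ((c - E c) * y) * c' := by noncomm_ring
      rw [h1]
      refine add_mem (add_mem ?_ (Submodule.mem_sup_right ?_)) (Submodule.mem_sup_right ?_)
      · exact mul_mem_sup_reducedSpan_of_right h hDB hDN (B.mul_mem hb (hDB (h.exp_mem c))) hy hc'
      · exact mem_reducedSpan hy (N.mul_mem (hDN hEb) hc₀) hc'
      · exact mem_reducedSpan_right (.cons (B.sub_mem hb (hDB hEb)) (h.exp_sub_exp _) hc₀
          (h.exp_sub_exp _) hy) hc'
    | zero => simp
    | add x y _ _ hx hy =>
      rw [mul_add]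
      exact add_mem hx hy
    | smul r x _ hx =>
      rw [mul_smul_comm]
      exact Submodule.smul_mem _ r hx

lemma sup_adjoin_le_sup_reducedSpan (h : IsTraceExpectation τ D E) (hDB : D ≤ B)
    (hN : N = D ⊔ Algebra.adjoin ℂ (Set.range X)) {a : M}
    (ha : a ∈ B ⊔ Algebra.adjoin ℂ (Set.range X)) :
    a ∈ Subalgebra.toSubmodule N ⊔ reducedSpan E N B := by
  have hDN : D ≤ N := hN ▸ le_sup_left
  have hXN : ∀ k, X k ∈ N := fun k =>
    hN ▸ le_sup_right (a := D) (Algebra.subset_adjoin ⟨k, rfl⟩)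
  set V := Subalgebra.toSubmodule N ⊔ reducedSpan E N B with hV
  suffices ∀ z ∈ V, a * z ∈ V by
    simpa using this 1 (Submodule.mem_sup_left N.one_mem)
  rw [sup_adjoin_range] at ha
  induction ha using Algebra.adjoin_induction with
  | mem x hx =>
    rcases hx with hx | ⟨k, rfl⟩
    · exact fun z hz => mul_mem_sup_reducedSpan h hDB hDN hx hz
    · intro z hz
      obtain ⟨a, ha, w, hw, rfl⟩ := Submodule.mem_sup.1 hz
      rw [mul_add]
      refine Submodule.add_mem_sup (N.mul_mem (hXN k) ha) ?_
      clear hz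
      induction hw using Submodule.span_induction with
      | mem p hp =>
        obtain ⟨m, y, c, c', hy, hc, hc', rfl⟩ := hp
        rw [← mul_assoc]
        exact mem_reducedSpan hy (N.mul_mem (hXN k) hc) hc'
      | zero => simp
      | add x y _ _ hx hy => rw [mul_add]; exact add_mem hx hy
      | smul r x _ hx => rw [mul_smul_comm]; exact Submodule.smul_mem _ r hx
  | algebraMap r =>
    intro z hz
    rw [← Algebra.smul_def]
    exact V.smul_mem r hz
  | add x y _ _ hx hy => exact fun z hz => by rw [add_mul]; exact add_mem (hx z hz) (hy z hz)
  | mul x y _ _ hx hy => exact fun z hz => by rw [mul_assoc]; exact hx _ (hy z hz)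

lemma isPerp_of_mem_reducedSpan (hτ : IsFaithfulTracialState τ)
    (hQ : ∀ m y, IsReduced E N B m y → ∀ c ∈ N, τ (c * y) = 0) {z : M}
    (hz : z ∈ reducedSpan E N B) : IsPerp τ N z := by
  induction hz using Submodule.span_induction with
  | mem p hp =>
    obtain ⟨m, y, c, c', hy, hc, hc', rfl⟩ := hp
    exact ((hy.isPerp hτ hQ).mul_right hc').mul_left hτ hc
  | zero => intro a _; simp
  | add x y _ _ hx hy => intro a ha; rw [add_mul, map_add, hx a ha, hy a ha, add_zero]
  | smul r x _ hx => intro a ha; rw [smul_mul_assoc, map_smul, hx a ha, smul_zero]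

lemma ConjugateEquations.map_mul_reducedSpan (hτ : IsFaithfulTracialState τ) (hDB : D ≤ B)
    (hN : N = D ⊔ Algebra.adjoin ℂ (Set.range X))
    (hQ : ∀ m y, IsReduced E N B m y → ∀ c ∈ N, τ (c * y) = 0) (hJ : ConjugateEquations τ B X J)
    (i : Fin n) {z : M} (hz : z ∈ reducedSpan E N B) : τ (J i * z) = 0 := by
  induction hz using Submodule.span_induction with
  | mem p hp =>
    obtain ⟨m, y, c, c', hy, hc, hc', rfl⟩ := hp
    obtain ⟨T, hT, hT'⟩ := exists_isDerivPair_vanishing hτ hDB hN hc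
    obtain ⟨S, hS, hS'⟩ := exists_isDerivPair_vanishing hτ hDB hN hc'
    obtain ⟨R, hR, hR'⟩ := hy.exists_isDerivPair_vanishing hτ hDB hN hQ
    have hp := hy.isPerp hτ hQ
    rw [(hT.mul (hR.mul hS)).map_mul hJ, leibniz_apply, leibniz_apply, one_mul, mul_one, mul_one,
      hT' i _ _ (Or.inr (hp.mul_right hc')), hR' i _ _ hc', hS' i _ _ (Or.inl (hp.mul_left hτ hc))]
    simp
  | zero => simp
  | add x y _ _ hx hy => rw [mul_add, map_add, hx, hy, add_zero]
  | smul r x _ hx => rw [mul_smul_comm, map_smul, hx, smul_zero]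

lemma phiStar_eq_of_reduced (h : IsTraceExpectation τ D E) (hDB : D ≤ B)
    (hB : ∀ b ∈ B, star b ∈ B) (hX : ∀ i, IsSelfAdjoint (X i))
    (hN : N = D ⊔ Algebra.adjoin ℂ (Set.range X))
    (hQ : ∀ m y, IsReduced E N B m y → ∀ c ∈ N, τ (c * y) = 0) (hJ : IsConjugateSystem τ B X J) :
    phiStar τ D X = phiStar τ B X := by
  have hτ := h.state
  rw [hJ.phiStar_eq hτ hB hX]
  refine IsConjugateSystem.phiStar_eq hτ h.star_mem hX ⟨fun i => ?_, hJ.2.mono hDB⟩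
  rw [memL2Closure_iff h.star_mem hX, ← hN]
  intro ε hε
  obtain ⟨a, ha, hlt⟩ := (memL2Closure_iff hB hX _).1 (hJ.1 i) ε hε
  obtain ⟨c, hc, w, hw, hcw⟩ := Submodule.mem_sup.1
    (sup_adjoin_le_sup_reducedSpan h hDB hN (star_mem_sup_adjoin hB hX a ha))
  have hsc : star c ∈ N := by rw [hN] at hc ⊢; exact star_mem_sup_adjoin h.star_mem hX c hc
  refine ⟨star c, hsc, lt_of_le_of_lt (Real.sqrt_le_sqrt ?_) hlt⟩
  have h1 : τ ((J i - star c) * w) = 0 := by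
    rw [sub_mul, map_sub, hJ.2.map_mul_reducedSpan hτ hDB hN hQ i hw, hτ.tracial,
      isPerp_of_mem_reducedSpan hτ hQ hw _ hsc, sub_zero]
  have h2 : τ (star w * star (J i - star c)) = 0 := by
    rw [← star_mul, hτ.map_star, h1, map_zero]
  have h3 : a = star c + star w := by rw [← star_add, hcw, star_star]
  have h4 : (J i - a) * star (J i - a) = (J i - star c) * star (J i - star c)
      - (J i - star c) * w - star w * star (J i - star c) + star w * w := by
    rw [h3]
    simp only [star_sub, star_add, star_star]
    noncomm_ring
  rw [h4, map_add, map_sub, map_sub, h1, h2, sub_zero, sub_zero, Complex.add_re]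
  linarith [(hτ.pos w).1]

end free_imp_eq

section eq_imp_free

variable {τ : M →ₗ[ℂ] ℂ} {B D N : Subalgebra ℂ M} {E : M →ₗ[ℂ] M} {X J : Fin n → M} {d : ℕ}
  {e f : Fin d → M}

/-- The form of the derivation `∑ᵢ [∂ᵢ(·), Xᵢ]`, compressed to `D` by the dual bases `e`, `f`. -/
def commForm (X : Fin n → M) (e f : Fin d → M) (T : Forms M n) (u v : M) : ℂ :=
  ∑ i, ∑ r, (T i (X i * (e r * u)) (v * f r) - T i (e r * u) (v * (f r * X i)))

lemma commForm_zero (u v : M) : commForm X e f 0 u v = 0 := by simp [commForm]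

lemma commForm_add (S T : Forms M n) (u v : M) :
    commForm X e f (S + T) u v = commForm X e f S u v + commForm X e f T u v := by
  simp only [commForm, ← Finset.sum_add_distrib]
  refine Finset.sum_congr rfl fun i _ => Finset.sum_congr rfl fun r _ => ?_
  simp only [Pi.add_apply, LinearMap.add_apply]
  ring

lemma commForm_leibniz (a : M) (T : Forms M n) (z : M) (Z : Forms M n) (u v : M) :
    commForm X e f (leibniz a T z Z) u v =
      commForm X e f T u (z * v) + commForm X e f Z (u * a) v := by
  simp only [commForm, ← Finset.sum_add_distrib]
  refine Finset.sum_congr rfl fun i _ => Finset.sum_congr rfl fun r _ => ?_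
  simp only [leibniz_apply, mul_assoc]
  ring

lemma commForm_varForm (hτ : IsFaithfulTracialState τ)
    (hef : ∀ x y, ∑ r, τ (x * e r) * τ (f r * y) = τ (E x * y)) (k : Fin n) (u v : M) :
    commForm X e f (varForm τ k) u v = τ (E (u * X k) * v) - τ (E u * (X k * v)) := by
  rw [commForm, Finset.sum_eq_single k, ← hef, ← hef, ← Finset.sum_sub_distrib]
  · refine Finset.sum_congr rfl fun r _ => ?_
    rw [varForm_apply, varForm_apply, if_pos rfl, if_pos rfl, ← mul_assoc, hτ.tracial (X k * e r),
      hτ.tracial (e r), hτ.tracial v (f r), ← mul_assoc v, hτ.tracial (v * f r),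
      hτ.tracial (X k) (v * f r)]
    simp only [mul_assoc]
    rw [hτ.tracial v, mul_assoc]
  · intro i _ hi
    simp [varForm_apply, hi.symm]
  · simp

lemma exists_isDerivPair_commForm (h : IsTraceExpectation τ D E) (hDB : D ≤ B)
    (hN : N = D ⊔ Algebra.adjoin ℂ (Set.range X))
    (hef : ∀ x y, ∑ r, τ (x * e r) * τ (f r * y) = τ (E x * y)) {a : M} (ha : a ∈ N) :
    ∃ T, IsDerivPair τ B X a T ∧
      ∀ u v, commForm X e f T u v = τ (E (u * a) * v) - τ (E u * (a * v)) := by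
  rw [hN] at ha
  refine exists_isDerivPair hDB (fun a T => ∀ u v, commForm X e f T u v =
    τ (E (u * a) * v) - τ (E u * (a * v))) (fun c hc u v => ?_) (fun k u v => ?_)
    (fun a T a' T' hT hT' u v => ?_) (fun a T a' T' hT hT' u v => ?_) ha
  · rw [commForm_zero, h.exp_mul_right hc, mul_assoc, sub_self]
  · exact commForm_varForm h.state hef k u v
  · rw [commForm_add, hT, hT']
    simp only [mul_add, add_mul, map_add]
    ring
  · rw [commForm_leibniz, hT, hT']
    simp only [mul_assoc]
    ring

/-- The commutator `∑ᵢ [Jᵢ, Xᵢ]`, compressed to the commutant of `D` by the dual bases `e`, `f`. -/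
def commSum (X J : Fin n → M) (e f : Fin d → M) : M :=
  ∑ i, ∑ r, f r * (J i * X i - X i * J i) * e r

lemma map_commSum_mul (hτ : IsFaithfulTracialState τ) (hDB : D ≤ B)
    (he : ∀ r, e r ∈ D) (hf : ∀ r, f r ∈ D) (hJ : ConjugateEquations τ B X J) {a : M}
    {T : Forms M n} (hT : IsDerivPair τ B X a T) :
    τ (commSum X J e f * a) = commForm X e f T 1 1 := by
  simp only [commSum, commForm, Finset.sum_mul, map_sum]
  refine Finset.sum_congr rfl fun i _ => Finset.sum_congr rfl fun r _ => ?_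
  have he' : IsDerivPair τ B X (e r) 0 := .of_mem (hDB (he r))
  have hf' : IsDerivPair τ B X (f r) 0 := .of_mem (hDB (hf r))
  have hX : IsDerivPair τ B X (X i) (varForm τ i) := .of_generator i
  have h1 := (hX.mul (he'.mul (hT.mul hf'))).map_mul hJ i
  have h2 := (he'.mul (hT.mul (hf'.mul hX))).map_mul hJ i
  have h3 : f r * (J i * X i - X i * J i) * e r * a =
      f r * (J i * (X i * (e r * a))) - f r * (X i * (J i * (e r * a))) := by noncomm_ring
  rw [h3, map_sub, hτ.tracial (f r), ← mul_assoc (f r) (X i), hτ.tracial (f r * X i)]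
  simp only [mul_assoc] at h1 h2 ⊢
  rw [h1, h2]
  simp only [leibniz_apply, varForm_apply, Pi.zero_apply, LinearMap.zero_apply, if_true, mul_one,
    one_mul, zero_add, add_zero, hτ.unital, mul_assoc]
  ring

lemma commSum_eq_zero (h : IsTraceExpectation τ D E) (hDB : D ≤ B)
    (hX : ∀ i, IsSelfAdjoint (X i)) (hN : N = D ⊔ Algebra.adjoin ℂ (Set.range X))
    (he : ∀ r, e r ∈ D) (hf : ∀ r, f r ∈ D)
    (hef : ∀ x y, ∑ r, τ (x * e r) * τ (f r * y) = τ (E x * y))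
    (hJ : ConjugateEquations τ B X J) (hlim : ∀ i, IsL2Limit τ N (J i)) :
    commSum X J e f = 0 := by
  have hτ := h.state
  have hDN : D ≤ N := hN ▸ le_sup_left
  have hXN : ∀ k, X k ∈ N := fun k =>
    hN ▸ le_sup_right (a := D) (Algebra.subset_adjoin ⟨k, rfl⟩)
  have hNs : ∀ a ∈ N, star a ∈ N := by rw [hN]; exact star_mem_sup_adjoin h.star_mem hX
  set j := commSum X J e f with hj
  have hperp : IsPerp τ N j := fun a ha => by
    obtain ⟨T, hT, hT'⟩ := exists_isDerivPair_commForm h hDB hN hef ha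
    rw [map_commSum_mul hτ hDB he hf hJ hT, hT']
    simp [h.condExp.1, h.map_exp]
  have hlim' : ∀ i, ∀ c ∈ N, ∀ c' ∈ N, τ (j * (c * star (J i) * c')) = 0 := by
    intro i c hc c' hc'
    have h1 : τ (c' * j * c * star (J i)) = 0 :=
      hτ.map_mul_eq_zero_of_approx ((hlim i).star hτ hNs)
        fun a ha => ((hperp.mul_left hτ hc').mul_right hc) a ha
    rw [← h1, ← mul_assoc, hτ.tracial]
    simp only [mul_assoc]
  apply hτ.eq_zero_of_map_mul_star
  have hsj : star j = ∑ i, ∑ r, (star (e r) * X i * star (J i) * star (f r) -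
      star (e r) * star (J i) * (X i * star (f r))) := by
    simp only [hj, commSum, star_sum, star_mul, star_sub, (hX _).star_eq]
    refine Finset.sum_congr rfl fun i _ => Finset.sum_congr rfl fun r _ => ?_
    noncomm_ring
  rw [hsj]
  simp only [Finset.mul_sum, map_sum, mul_sub, map_sub]
  refine Finset.sum_eq_zero fun i _ => Finset.sum_eq_zero fun r _ => ?_
  have hse := hDN (h.star_mem _ (he r))
  have hsf := hDN (h.star_mem _ (hf r))
  rw [hlim' i _ (N.mul_mem hse (hXN i)) _ hsf, hlim' i _ hse _ (N.mul_mem (hXN i) hsf), sub_zero]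

lemma IsReduced.exists_mul_eq (h : IsTraceExpectation τ D E) (hDB : D ≤ B) (hDN : D ≤ N) {b : M}
    (hb : b ∈ B) {m : ℕ} {w : M} (hw : IsReduced E N B m w) :
    ∃ w', IsReduced E N B m w' ∧ (w * b - w' ∈ D ∨
      ∃ m' < m, ∃ y, ∃ c ∈ N, IsReduced E N B m' y ∧ w * b - w' = y * c) := by
  induction hw with
  | @single b₁ hb₁ =>
    refine ⟨_, .single (B.sub_mem (B.mul_mem hb₁ hb) (hDB (h.exp_mem _))) (h.exp_sub_exp _),
      Or.inl ?_⟩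
    rw [sub_sub_cancel]
    exact h.exp_mem _
  | @cons b₁ c₁ w m hb₁ hEb₁ hc₁ hEc₁ hw ih =>
    obtain ⟨w', hw', hd⟩ := ih
    refine ⟨_, .cons hb₁ hEb₁ hc₁ hEc₁ hw', Or.inr ?_⟩
    have h1 : b₁ * (c₁ * w) * b - b₁ * (c₁ * w') = b₁ * (c₁ * (w * b - w')) := by noncomm_ring
    rw [h1]
    rcases hd with hd | ⟨m', hm', y, c, hc, hy, hd⟩
    · exact ⟨0, m.succ_pos, b₁, _, N.mul_mem hc₁ (hDN hd), .single hb₁ hEb₁, rfl⟩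
    · exact ⟨m' + 1, Nat.succ_lt_succ hm', _, c, hc, .cons hb₁ hEb₁ hc₁ hEc₁ hy, by
        rw [hd]; simp only [mul_assoc]⟩

lemma IsReduced.exists_isDerivPair_commForm (h : IsTraceExpectation τ D E) (hDB : D ≤ B)
    (hN : N = D ⊔ Algebra.adjoin ℂ (Set.range X))
    (hef : ∀ x y, ∑ r, τ (x * e r) * τ (f r * y) = τ (E x * y)) {m : ℕ} {w : M}
    (hw : IsReduced E N B m w)
    (hlt : ∀ m' < m, ∀ y, IsReduced E N B m' y → ∀ c ∈ N, τ (c * y) = 0) :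
    ∃ T, IsDerivPair τ B X w T ∧ ∀ u, commForm X e f T u 1 = 0 := by
  have hDN : D ≤ N := hN ▸ le_sup_left
  induction hw with
  | single hb => exact ⟨0, .of_mem hb, fun u => commForm_zero u 1⟩
  | @cons b c w m hb hEb hc hEc hw ih =>
    obtain ⟨S, hS, hS'⟩ := ih fun m' hm' => hlt m' (hm'.trans m.lt_succ_self)
    obtain ⟨T, hT, hT'⟩ := OVD.exists_isDerivPair_commForm h hDB hN hef hc
    refine ⟨_, (IsDerivPair.of_mem hb).mul (hT.mul hS), fun u => ?_⟩
    have hw' := hlt m m.lt_succ_self w hw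
    rw [commForm_leibniz, commForm_leibniz, commForm_zero, hS', hT', mul_one,
      hw' _ (hDN (h.exp_mem _)), ← mul_assoc, hw' _ (N.mul_mem (hDN (h.exp_mem _)) hc)]
    simp

lemma map_mul_reduced_eq_zero (h : IsTraceExpectation τ D E) (hDB : D ≤ B)
    (hN : N = D ⊔ Algebra.adjoin ℂ (Set.range X))
    (hef : ∀ x y, ∑ r, τ (x * e r) * τ (f r * y) = τ (E x * y))
    (hcomm : ∀ a T, IsDerivPair τ B X a T → commForm X e f T 1 1 = 0) (m : ℕ) :
    ∀ w, IsReduced E N B m w → ∀ c ∈ N, τ (c * w) = 0 := by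
  have hτ := h.state
  have hDN : D ≤ N := hN ▸ le_sup_left
  induction m using Nat.strong_induction_on with
  | _ m ih =>
  intro w hw c hc
  have hcentered : τ ((c - E c) * w) = 0 := by
    obtain ⟨S, hS, hS'⟩ := hw.exists_isDerivPair_commForm h hDB hN hef ih
    obtain ⟨T, hT, hT'⟩ := exists_isDerivPair_commForm h hDB hN hef
      (N.sub_mem hc (hDN (h.exp_mem c)))
    have h1 := hcomm _ _ (hT.mul hS)
    rw [commForm_leibniz, hS', hT', one_mul, h.exp_sub_exp, h.condExp.1] at h1
    simpa using h1
  have hexp : ∀ a ∈ D, τ (a * w) = 0 := by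
    intro a ha
    cases hw with
    | single hb hEb => exact h.map_mul_eq_zero ha hEb
    | @cons b c₁ w m hb hEb hc₁ hEc₁ hw =>
      obtain ⟨w', hw', hd⟩ := hw.exists_mul_eq h hDB hDN (B.mul_mem (hDB ha) hb)
      have h1 : τ (a * (b * (c₁ * w))) = τ (c₁ * w') + τ (c₁ * (w * (a * b) - w')) := by
        rw [← map_add, ← mul_assoc, hτ.tracial]
        congr 1
        noncomm_ring
      rw [h1, ih m m.lt_succ_self w' hw' c₁ hc₁, zero_add]
      rcases hd with hd | ⟨m', hm', y, c₂, hc₂, hy, hd⟩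
      · rw [hτ.tracial]
        exact h.map_mul_eq_zero hd hEc₁
      · rw [hd, ← mul_assoc, hτ.tracial, ← mul_assoc]
        exact ih m' (hm'.trans m.lt_succ_self) y hy _ (N.mul_mem hc₂ hc₁)
  rw [← sub_add_cancel c (E c), add_mul, map_add, hcentered, hexp _ (h.exp_mem c), add_zero]

end eq_imp_free

theorem fisher_informations_equal_iff_free
    (τ : M →ₗ[ℂ] ℂ) (hτ : IsFaithfulTracialState τ)
    (B : Subalgebra ℂ M) (hBstar : ∀ b ∈ B, star b ∈ B)
    (D : Subalgebra ℂ M) (hDB : D ≤ B) [FiniteDimensional ℂ ↥D]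
    (hDstar : ∀ d ∈ D, star d ∈ D)
    (ED : M →ₗ[ℂ] M) (hED : IsCondExp D ED) (hEDτ : ∀ x, τ (ED x) = τ x)
    {n : ℕ} (X : Fin n → M) (hX : ∀ i, IsSelfAdjoint (X i))
    (hfin : phiStar τ B X ≠ ⊤) :
    (phiStar τ D X = phiStar τ B X ↔
      IsFreeWithAmalgamation ED
        ((D ⊔ Algebra.adjoin ℂ (Set.range X) : Subalgebra ℂ M) : Set M)
        (B : Set M)) := by
  have h : IsTraceExpectation τ D ED := ⟨hτ, hDstar, hED, hEDτ⟩
  obtain ⟨J, hJ⟩ := exists_isConjugateSystem hfin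
  rw [isFreeWithAmalgamation_iff_s17 h le_sup_left]
  constructor
  · intro heq m
    obtain ⟨d, e, f, he, hf, hef⟩ := h.exists_dual_basis
    refine map_mul_reduced_eq_zero h hDB rfl hef (fun a T hT => ?_) m
    rw [← map_commSum_mul hτ hDB he hf hJ.2 hT, commSum_eq_zero h hDB hX rfl he hf hef hJ.2
      fun i => isL2Limit_of_phiStar_eq hτ hBstar hDstar hDB hX hJ heq i, zero_mul, map_zero]
  · intro hQ
    exact phiStar_eq_of_reduced h hDB hBstar hX rfl hQ hJ

end OVD
end
end
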